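/- arXiv:1612.02279 — 4 statements merged into one kernel-verified Lean document; each statement's English description precedes it below -/
import Mathlib

section
/- Let r, λ > 0 and let h : ℝ → ℝ be Lipschitz-continuous. Then there exists a Lipschitz-continuous solution f_h on all of ℝ of the Gamma Stein equation x f'(x) + (r − λx) f(x) = h(x) − E[h(X_{r,λ})] which satisfies the bounds sup_{x∈ℝ}|f_h(x)| ≤ λ^{−1}‖h'‖ and ‖f_h'‖ ≤ 2·max(1, 1/r)·‖h'‖, where ‖h'‖ and ‖f_h'‖ denote minimum Lipschitz constants. -/
open MeasureTheory ProbabilityTheory Real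

/-- The minimum Lipschitz constant `‖g'‖ = sup_{x ≠ y} |g x - g y| / |x - y|` of `g : ℝ → ℝ`. -/
noncomputable def lipConst (g : ℝ → ℝ) : ℝ :=
  sSup {c | ∃ x y : ℝ, x ≠ y ∧ c = |g x - g y| / |x - y|}

open Set Filter Topology

noncomputable def gW (r l t : ℝ) : ℝ := t ^ (r - 1) * exp (-(l * t))
noncomputable def gA (r l t : ℝ) : ℝ := t ^ r * exp (-(l * t))
noncomputable def gI (r l : ℝ) (H : ℝ → ℝ) (x : ℝ) : ℝ := ∫ t in (0 : ℝ)..x, H t * gW r l t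
noncomputable def gG (r l : ℝ) (H : ℝ → ℝ) (x : ℝ) : ℝ := gA r l x * H x - (r - l * x) * gI r l H x
noncomputable def gF (r l : ℝ) (H : ℝ → ℝ) (x : ℝ) : ℝ :=
  if x = 0 then H 0 / r else gI r l H x / gA r l x

lemma gA_pos {r l x : ℝ} (hx : 0 < x) : 0 < gA r l x := by unfold gA; positivity
lemma gW_pos {r l x : ℝ} (hx : 0 < x) : 0 < gW r l x := by unfold gW; positivity
lemma gW_nonneg {r l x : ℝ} (hx : 0 ≤ x) : 0 ≤ gW r l x := by unfold gW; positivity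

lemma gA_eq {r l x : ℝ} (hx : 0 < x) : gA r l x = x * gW r l x := by
  unfold gA gW
  rw [rpow_sub_one hx.ne']; field_simp

lemma gA_deriv {r l x : ℝ} (hx : 0 < x) : HasDerivAt (gA r l) ((r - l * x) * gW r l x) x := by
  have h1 := (Real.hasDerivAt_rpow_const (x := x) (p := r) (Or.inl hx.ne'))
  have h2 : HasDerivAt (fun t : ℝ => exp (-(l * t))) (exp (-(l * x)) * (-(l * 1))) x :=
    (((hasDerivAt_id x).const_mul l).neg).exp
  have h3 := h1.mul h2
  refine (h3.congr_deriv ?_)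
  unfold gW
  rw [rpow_sub_one hx.ne']; field_simp; ring

lemma gA_cont {r : ℝ} (l : ℝ) (hr : 0 < r) : Continuous (gA r l) := by
  unfold gA
  exact (Real.continuous_rpow_const hr.le).mul (by fun_prop)

lemma gW_contAt {r l x : ℝ} (hx : 0 < x) : ContinuousAt (gW r l) x := by
  unfold gW
  exact (Real.continuousAt_rpow_const x _ (Or.inl hx.ne')).mul (by fun_prop)

lemma gW_int {r : ℝ} (l : ℝ) (hr : 0 < r) {H : ℝ → ℝ} (hH : Continuous H) (a b : ℝ) :
    IntervalIntegrable (fun t => H t * gW r l t) volume a b := by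
  have h1 : IntervalIntegrable (fun t : ℝ => t ^ (r - 1)) volume a b :=
    intervalIntegral.intervalIntegrable_rpow' (by linarith)
  have h2 := h1.mul_continuousOn (g := fun t => exp (-(l * t)) * H t) (by fun_prop)
  refine h2.congr ?_
  intro t _
  simp only [gW]; ring

lemma gA_int {r : ℝ} (l : ℝ) (hr : 0 < r) {x y : ℝ} (hx : 0 ≤ x) (hxy : x ≤ y) :
    ∫ t in x..y, (r - l * t) * gW r l t = gA r l y - gA r l x := by
  refine intervalIntegral.integral_eq_sub_of_hasDerivAt_of_le hxy (gA_cont l hr).continuousOn ?_ ?_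
  · intro t ht
    exact gA_deriv (lt_of_le_of_lt hx ht.1)
  · exact gW_int l hr (by fun_prop) _ _

lemma gA_zero {r l : ℝ} (hr : 0 < r) : gA r l 0 = 0 := by
  simp [gA, Real.zero_rpow hr.ne']

lemma gI_deriv {r : ℝ} (l : ℝ) (hr : 0 < r) {H : ℝ → ℝ} (hH : Continuous H) {x : ℝ} (hx : 0 < x) :
    HasDerivAt (gI r l H) (H x * gW r l x) x := by
  unfold gI
  have hc : ∀ t > 0, ContinuousAt (fun t => H t * gW r l t) t := fun t ht =>
    hH.continuousAt.mul (gW_contAt ht)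
  refine intervalIntegral.integral_hasDerivAt_right (gW_int l hr hH 0 x) ?_ (hc x hx)
  exact ContinuousAt.stronglyMeasurableAtFilter isOpen_Ioi hc x hx

lemma gF_deriv {r : ℝ} (l : ℝ) (hr : 0 < r) {H : ℝ → ℝ} (hH : Continuous H) {x : ℝ} (hx : 0 < x) :
    HasDerivAt (gF r l H) ((H x - (r - l * x) * gF r l H x) / x) x := by
  have h1 := (gI_deriv l hr hH hx).div (gA_deriv (r := r) (l := l) hx) (gA_pos hx).ne'
  have h2 : gF r l H =ᶠ[𝓝 x] fun x => gI r l H x / gA r l x := by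
    filter_upwards [lt_mem_nhds hx] with t ht
    simp [gF, ht.ne']
  have h3 := h1.congr_of_eventuallyEq h2
  refine h3.congr_deriv ?_
  have := gW_pos (r := r) (l := l) hx
  simp only [gF, hx.ne', if_false, gA_eq hx]
  field_simp

lemma gF_deriv' {r : ℝ} (l : ℝ) {H : ℝ → ℝ} {x : ℝ} (hx : 0 < x) :
    (H x - (r - l * x) * gF r l H x) / x = gG r l H x / (x * gA r l x) := by
  have := gA_pos (r := r) (l := l) hx
  simp only [gF, hx.ne', if_false, gG]
  field_simp

lemma gF_tendsto {r : ℝ} (l : ℝ) (hr : 0 < r) {H : ℝ → ℝ} (hH : Continuous H) :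
    ContinuousWithinAt (gF r l H) (Ici 0) 0 := by
  have hF0 : gF r l H 0 = H 0 / r := by simp [gF]
  -- gI / x^r → H 0 / r
  have key : Tendsto (fun x => gI r l H x / x ^ r) (𝓝[>] 0) (𝓝 (H 0 / r)) := by
    rw [Metric.tendsto_nhdsWithin_nhds]
    intro ε hε
    have hc : Continuous (fun t => H t * exp (-(l * t))) := by fun_prop
    obtain ⟨δ, hδ, hd⟩ := Metric.continuous_iff.1 hc 0 (ε * r / 2) (by positivity)
    refine ⟨δ, hδ, ?_⟩
    intro x hx hxd
    have hx0 : 0 < x := hx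
    have e1 : ∫ t in (0:ℝ)..x, t ^ (r - 1) = x ^ r / r := by
      rw [integral_rpow (Or.inl (by linarith))]
      simp [Real.zero_rpow hr.ne']
    have i1 : IntervalIntegrable (fun t : ℝ => t ^ (r - 1)) volume 0 x :=
      intervalIntegral.intervalIntegrable_rpow' (by linarith)
    have e2 : gI r l H x - H 0 * (x ^ r / r) =
        ∫ t in (0:ℝ)..x, (H t * exp (-(l * t)) - H 0) * t ^ (r - 1) := by
      rw [← e1, gI, ← intervalIntegral.integral_const_mul, ← intervalIntegral.integral_sub
        (gW_int l hr hH _ _) (i1.const_mul _)]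
      congr 1; ext t; simp only [gW]; ring
    have e3 : |gI r l H x - H 0 * (x ^ r / r)| ≤ (ε * r / 2) * (x ^ r / r) := by
      rw [e2, ← e1, ← intervalIntegral.integral_const_mul, ← Real.norm_eq_abs]
      refine intervalIntegral.norm_integral_le_of_norm_le hx0.le ?_ (i1.const_mul _)
      refine ae_of_all _ fun t ht => ?_
      have ht0 : 0 < t := ht.1
      have := hd t (by
        rw [Real.dist_eq, sub_zero, abs_of_pos ht0]
        rw [Real.dist_eq, sub_zero, abs_of_pos hx0] at hxd
        exact lt_of_le_of_lt ht.2 hxd)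
      simp only [mul_zero, neg_zero, exp_zero, mul_one, Real.dist_eq] at this
      rw [Real.norm_eq_abs, abs_mul, abs_of_pos (rpow_pos_of_pos ht0 _)]
      gcongr
    have hp : 0 < x ^ r := rpow_pos_of_pos hx0 _
    rw [Real.dist_eq]
    have : gI r l H x / x ^ r - H 0 / r = (gI r l H x - H 0 * (x ^ r / r)) / x ^ r := by
      field_simp
    rw [this, abs_div, abs_of_pos hp, div_lt_iff₀ hp]
    refine lt_of_le_of_lt e3 ?_
    have : (ε * r / 2) * (x ^ r / r) = ε * x ^ r / 2 := by field_simp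
    rw [this]
    have : 0 < ε * x ^ r := by positivity
    linarith
  have key2 : Tendsto (fun x => exp (l * x)) (𝓝[>] 0) (𝓝 1) := by
    have : Continuous (fun x => exp (l * x)) := by fun_prop
    have := this.tendsto 0
    simp only [mul_zero, exp_zero] at this
    exact this.mono_left nhdsWithin_le_nhds
  have h3 := key.mul key2
  rw [mul_one] at h3
  have : ContinuousWithinAt (gF r l H) (Ioi 0) 0 := by
    unfold ContinuousWithinAt
    rw [hF0]
    refine h3.congr' ?_
    filter_upwards [self_mem_nhdsWithin] with t ht
    have ht0 : 0 < t := ht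
    simp only [gF, ht0.ne', if_false, gA, exp_neg]
    have := rpow_pos_of_pos ht0 r
    field_simp
  exact continuousWithinAt_Ioi_iff_Ici.1 this

lemma gG_diff {r : ℝ} (l : ℝ) (hr : 0 < r) {H : ℝ → ℝ} {K : NNReal} (hH : LipschitzWith K H)
    (hB : ∀ t, 0 < t → |l| * |gI r l H t| ≤ K * gA r l t) {x y : ℝ} (hx : 0 < x) (hxy : x ≤ y) :
    |gG r l H y - gG r l H x| ≤ 2 * K * ∫ t in x..y, gA r l t := by
  have hpos : ∀ t ∈ uIcc x y, 0 < t := by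
    intro t ht; rw [uIcc_of_le hxy] at ht; exact lt_of_lt_of_le hx ht.1
  have acH : AbsolutelyContinuousOnInterval H x y :=
    (hH.lipschitzOnWith (s := uIcc x y)).absolutelyContinuousOnInterval
  have acA : AbsolutelyContinuousOnInterval (gA r l) x y := by
    refine ContDiffOn.absolutelyContinuousOnInterval ?_
    intro t ht
    refine ContDiffAt.contDiffWithinAt ?_
    unfold gA
    exact (Real.contDiffAt_rpow_const_of_ne (hpos t ht).ne').mul (by fun_prop)
  have bp := acA.integral_mul_deriv_eq_deriv_mul acH
  have cI : ContinuousOn (gI r l H) (uIcc x y) := fun t ht =>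
    (gI_deriv l hr hH.continuous (hpos t ht)).continuousAt.continuousWithinAt
  have iI : IntervalIntegrable (gI r l H) volume x y := cI.intervalIntegrable
  have iW : IntervalIntegrable (fun t => (r - l * t) * H t * gW r l t) volume x y :=
    gW_int l hr (H := fun t => (r - l * t) * H t) (by have := hH.continuous; fun_prop) x y
  have ft : ∫ t in x..y, (-l * gI r l H t + (r - l * t) * H t * gW r l t) =
      (r - l * y) * gI r l H y - (r - l * x) * gI r l H x := by
    refine intervalIntegral.integral_eq_sub_of_hasDerivAt (f := fun t => (r - l * t) * gI r l H t)
      ?_ ((iI.const_mul (-l)).add iW)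
    intro t ht
    have h1 : HasDerivAt (fun t => r - l * t) (-l) t := by
      simpa using ((hasDerivAt_id t).const_mul l).const_sub r
    refine (h1.mul (gI_deriv l hr hH.continuous (hpos t ht))).congr_deriv ?_
    ring
  rw [intervalIntegral.integral_add (iI.const_mul (-l)) iW,
    intervalIntegral.integral_const_mul] at ft
  have e1 : ∫ t in x..y, deriv (gA r l) t * H t = ∫ t in x..y, (r - l * t) * H t * gW r l t := by
    refine intervalIntegral.integral_congr fun t ht => ?_
    rw [(gA_deriv (hpos t ht)).deriv]; ring
  rw [e1] at bp
  have iAH : IntervalIntegrable (fun t => gA r l t * deriv H t) volume x y :=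
    acH.intervalIntegrable_deriv.continuousOn_mul (gA_cont l hr).continuousOn
  have e2 : gG r l H y - gG r l H x = ∫ t in x..y, (gA r l t * deriv H t + l * gI r l H t) := by
    rw [intervalIntegral.integral_add iAH (iI.const_mul l), bp,
      intervalIntegral.integral_const_mul]
    unfold gG
    linarith
  rw [e2, ← intervalIntegral.integral_const_mul, ← Real.norm_eq_abs]
  refine intervalIntegral.norm_integral_le_of_norm_le hxy ?_
    (((gA_cont l hr).intervalIntegrable _ _).const_mul _)
  refine ae_of_all _ fun t ht => ?_
  have ht0 : 0 < t := hx.trans ht.1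
  have hA := gA_pos (r := r) (l := l) ht0
  have h1 : |deriv H t| ≤ K := norm_deriv_le_of_lipschitz hH
  have h2 := hB t ht0
  rw [Real.norm_eq_abs]
  refine (abs_add_le _ _).trans ?_
  rw [abs_mul, abs_mul, abs_of_pos hA]
  nlinarith

lemma one_add_exp_le (v : ℝ) : (1 + v) * exp (-v) ≤ 1 := by
  have := Real.add_one_le_exp v
  rw [exp_neg, ← div_eq_mul_inv, div_le_one (exp_pos _)]; linarith

/-- normalized form of `gA` -/
lemma gA_ratio {r l x u : ℝ} (hx : 0 < x) (hu : 0 < u) :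
    gA r l (x * u) = gA r l x * ((u * exp (1 - u)) ^ r * exp ((l * x - r) * (1 - u))) := by
  unfold gA
  rw [mul_rpow hx.le hu.le, mul_rpow hu.le (exp_pos _).le, ← Real.exp_mul]
  have : exp (-(l * (x * u))) = exp (-(l * x)) * (exp ((1 - u) * r) *
    exp ((l * x - r) * (1 - u))) := by
    rw [← exp_add, ← exp_add]; congr 1; ring
  rw [this]; ring

lemma uexp_le (u : ℝ) : u * exp (1 - u) ≤ 1 := by
  have := one_add_exp_le (u - 1)
  convert this using 2 <;> ring_nf

lemma pow_mono_rho {r s u : ℝ} (hu : 0 < u) (hs : s ≤ r) :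
    (u * exp (1 - u)) ^ r ≤ (u * exp (1 - u)) ^ s :=
  Real.rpow_le_rpow_of_exponent_ge (by positivity) (uexp_le u) hs

lemma ratioA {r l x u s : ℝ} (hs0 : 0 < s) (hs1 : s ≤ 1) (hsr : s ≤ r) (hx : 0 < x)
    (hw : l * x ≤ r + 2 / 3 * s) (hu : 0 < u) (hu1 : u ≤ 1) :
    gA r l (x * u) ≤ gA r l x * (1 - s + s * (u * exp (5 / 3 * (1 - u)))) := by
  rw [gA_ratio hx hu]
  refine mul_le_mul_of_nonneg_left ?_ (gA_pos hx).le
  calc _ ≤ (u * exp (1 - u)) ^ s * exp ((2 / 3 * s) * (1 - u)) := by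
        refine mul_le_mul (pow_mono_rho hu hsr) ?_ (exp_pos _).le (by positivity)
        apply exp_le_exp.2
        nlinarith
    _ = (1 + (u * exp (5 / 3 * (1 - u)) - 1)) ^ s := by
        rw [show (2 / 3 * s) * (1 - u) = (2 / 3 * (1 - u)) * s by ring, Real.exp_mul,
          ← mul_rpow (by positivity) (by positivity), mul_assoc, ← exp_add]
        congr 1
        rw [show 1 - u + 2 / 3 * (1 - u) = 5 / 3 * (1 - u) by ring]; ring
    _ ≤ 1 + s * (u * exp (5 / 3 * (1 - u)) - 1) := by
        apply rpow_one_add_le_one_add_mul_self _ hs0.le hs1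
        have : 0 < u * exp (5 / 3 * (1 - u)) := by positivity
        linarith
    _ = _ := by ring

lemma ratioB {r l x v s : ℝ} (hs0 : 0 < s) (hs1 : s ≤ 1) (hsr : s ≤ r) (hx : 0 < x)
    (hw : r + 2 / 3 * s ≤ l * x) (hv : 0 ≤ v) :
    gA r l (x * (1 + v)) ≤ gA r l x * ((1 + s * v) * exp (-(5 / 3 * s * v))) := by
  rw [gA_ratio hx (by linarith)]
  refine mul_le_mul_of_nonneg_left ?_ (gA_pos hx).le
  calc _ ≤ ((1 + v) * exp (1 - (1 + v))) ^ s * exp ((2 / 3 * s) * (1 - (1 + v))) := by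
        refine mul_le_mul (pow_mono_rho (by linarith) hsr) ?_ (exp_pos _).le (by positivity)
        apply exp_le_exp.2
        nlinarith
    _ = (1 + v) ^ s * exp (-(5 / 3 * s * v)) := by
        rw [mul_rpow (by positivity) (by positivity), ← Real.exp_mul, mul_assoc, ← exp_add]
        congr 2; ring
    _ ≤ _ := by
        refine mul_le_mul_of_nonneg_right ?_ (exp_pos _).le
        exact rpow_one_add_le_one_add_mul_self (by linarith) hs0.le hs1

lemma exp53 : exp (5 / 3) ≤ 49 / 9 := by
  have h : exp (5/3) ^ 3 ≤ (49/9 : ℝ) ^ 3 := by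
    rw [← Real.exp_nat_mul]
    have : exp ((3:ℕ) * (5/3 : ℝ)) = exp 1 ^ 5 := by rw [← Real.exp_nat_mul]; norm_num
    rw [this]
    have h1 := Real.exp_one_lt_d9
    calc exp 1 ^ 5 ≤ (2.7182818286 : ℝ) ^ 5 := by gcongr
      _ ≤ _ := by norm_num
  exact le_of_pow_le_pow_left₀ (by norm_num) (by norm_num) h

lemma intA {r l x s : ℝ} (hr : 0 < r) (hs0 : 0 < s) (hs1 : s ≤ 1) (hsr : s ≤ r) (hx : 0 < x)
    (hw : l * x ≤ r + 2 / 3 * s) : ∫ t in (0 : ℝ)..x, gA r l t ≤ x * gA r l x := by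
  have e : ∫ t in (0 : ℝ)..x, gA r l t = x * ∫ u in (0 : ℝ)..1, gA r l (x * u) := by
    rw [intervalIntegral.integral_comp_mul_left _ hx.ne']
    simp [hx.ne']
  rw [e]
  refine mul_le_mul_of_nonneg_left ?_ hx.le
  have c1 : Continuous fun u => gA r l (x * u) := (gA_cont l hr).comp (by fun_prop)
  calc ∫ u in (0 : ℝ)..1, gA r l (x * u)
      ≤ ∫ u in (0 : ℝ)..1, gA r l x * (1 - s + s * (u * exp (5 / 3 * (1 - u)))) := by
        refine intervalIntegral.integral_mono_on_of_le_Ioo zero_le_one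
          (c1.intervalIntegrable _ _)
          (Continuous.intervalIntegrable (by fun_prop) _ _) ?_
        intro u hu
        exact ratioA hs0 hs1 hsr hx hw hu.1 hu.2.le
    _ = gA r l x * ((1 - s) * 1 - s * ((3/5*1 + 9/25) * exp (5/3*(1-1)))) -
        gA r l x * ((1 - s) * 0 - s * ((3/5*0 + 9/25) * exp (5/3*(1-0)))) := by
        refine intervalIntegral.integral_eq_sub_of_hasDerivAt
          (f := fun u => gA r l x * ((1 - s) * u - s * ((3/5*u + 9/25) * exp (5/3*(1-u))))) ?_
          (Continuous.intervalIntegrable (by fun_prop) _ _)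
        intro u _
        have h1 : HasDerivAt (fun u : ℝ => exp (5/3*(1-u))) (exp (5/3*(1-u)) * (5/3 * (-1))) u :=
          (((hasDerivAt_id u).const_sub 1).const_mul (5/3)).exp
        have h2 : HasDerivAt (fun u : ℝ => 3/5*u + 9/25) (3/5 * 1) u :=
          ((hasDerivAt_id u).const_mul _).add_const _
        have h3 := (((hasDerivAt_id u).const_mul (1 - s)).sub ((h2.mul h1).const_mul s)).const_mul
          (gA r l x)
        refine h3.congr_deriv ?_
        ring
    _ ≤ gA r l x := by
        have hA := gA_pos (r := r) (l := l) hx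
        have := exp53
        norm_num
        nlinarith [mul_le_mul_of_nonneg_left this (mul_pos hA hs0).le, mul_pos hA hs0]

lemma intB {r l x y s : ℝ} (hr : 0 < r) (hs0 : 0 < s) (hs1 : s ≤ 1) (hsr : s ≤ r) (hx : 0 < x)
    (hxy : x ≤ y) (hw : r + 2 / 3 * s ≤ l * x) :
    ∫ t in x..y, gA r l t ≤ 1 / s * (x * gA r l x) := by
  set V := y / x - 1 with hV
  have hV0 : 0 ≤ V := by rw [hV, sub_nonneg, one_le_div hx]; exact hxy
  have e : ∫ t in x..y, gA r l t = x * ∫ v in (0 : ℝ)..V, gA r l (x * (1 + v)) := by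
    have := intervalIntegral.integral_comp_mul_add (a := 0) (b := V) (fun t => gA r l t) hx.ne' x
    have h2 : (fun v => gA r l (x * (1 + v))) = fun v => gA r l (x * v + x) := by
      ext v; congr 1; ring
    have h3 : x * V + x = y := by rw [hV]; field_simp; ring
    rw [h2, this, h3]
    simp [hx.ne']
  rw [e, mul_left_comm]
  refine mul_le_mul_of_nonneg_left ?_ hx.le
  have c1 : Continuous fun v => gA r l (x * (1 + v)) := (gA_cont l hr).comp (by fun_prop)
  calc ∫ v in (0 : ℝ)..V, gA r l (x * (1 + v))
      ≤ ∫ v in (0 : ℝ)..V, gA r l x * ((1 + s * v) * exp (-(5 / 3 * s * v))) := by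
        refine intervalIntegral.integral_mono_on_of_le_Ioo hV0
          (c1.intervalIntegrable _ _)
          (Continuous.intervalIntegrable (by fun_prop) _ _) ?_
        intro u hu
        exact ratioB hs0 hs1 hsr hx hw hu.1.le
    _ = gA r l x / s * (-(3/5 * (s * V) + 24/25) * exp (-(5 / 3 * s * V))) -
        gA r l x / s * (-(3/5 * (s * 0) + 24/25) * exp (-(5 / 3 * s * 0))) := by
        refine intervalIntegral.integral_eq_sub_of_hasDerivAt
          (f := fun v => gA r l x / s * (-(3/5 * (s * v) + 24/25) * exp (-(5 / 3 * s * v)))) ?_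
          (Continuous.intervalIntegrable (by fun_prop) _ _)
        intro u _
        have h1 : HasDerivAt (fun u : ℝ => exp (-(5/3*s*u))) (exp (-(5/3*s*u)) * (-(5/3*s*1))) u :=
          (((hasDerivAt_id u).const_mul (5/3*s)).neg).exp
        have h2 : HasDerivAt (fun u : ℝ => -(3/5*(s*u) + 24/25)) (-(3/5 * (s * 1))) u :=
          ((((hasDerivAt_id u).const_mul s).const_mul _).add_const _).neg
        refine ((h2.mul h1).const_mul (gA r l x / s)).congr_deriv ?_
        field_simp
        ring
    _ ≤ 1 / s * gA r l x := by
        have hA := gA_pos (r := r) (l := l) hx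
        have : 0 < gA r l x / s := by positivity
        have h5 : 0 ≤ gA r l x / s * ((3/5 * (s * V) + 24/25) * exp (-(5 / 3 * s * V))) := by
          positivity
        rw [show 1 / s * gA r l x = gA r l x / s by ring]
        simp only [mul_zero, neg_zero, exp_zero]
        nlinarith

lemma gI_cont {r : ℝ} (l : ℝ) (hr : 0 < r) {H : ℝ → ℝ} (hH : Continuous H) :
    Continuous (gI r l H) :=
  intervalIntegral.continuous_primitive (fun a b => gW_int l hr hH a b) 0

lemma gI_zero {r l : ℝ} {H : ℝ → ℝ} : gI r l H 0 = 0 := by simp [gI]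

lemma gA_top {r l : ℝ} (hl : 0 < l) : Tendsto (gA r l) atTop (𝓝 0) := by
  have := tendsto_rpow_mul_exp_neg_mul_atTop_nhds_zero r l hl
  refine this.congr fun x => ?_
  simp [gA]

lemma gG_top {r l : ℝ} (hl : 0 < l) {H : ℝ → ℝ} {K : NNReal} (hH : LipschitzWith K H)
    (hB : ∀ t, 0 < t → |l| * |gI r l H t| ≤ K * gA r l t) : Tendsto (gG r l H) atTop (𝓝 0) := by
  have h1 : Tendsto (fun x => (|H 0| + |r| * (K / l)) * gA r l x + 2 * K * gA (r + 1) l x) atTop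
      (𝓝 0) := by
    simpa using ((gA_top (r := r) hl).const_mul (|H 0| + |r| * (K / l))).add
      ((gA_top (r := r + 1) hl).const_mul (2 * K : ℝ))
  refine squeeze_zero_norm' ?_ h1
  filter_upwards [eventually_gt_atTop 0] with x hx
  have hA := gA_pos (r := r) (l := l) hx
  have e : gA (r + 1) l x = x * gA r l x := by
    unfold gA; rw [rpow_add_one hx.ne']; ring
  have hI : |gI r l H x| ≤ K / l * gA r l x := by
    have := hB x hx
    rw [abs_of_pos hl] at this
    rw [div_mul_eq_mul_div, le_div_iff₀ hl]; linarith
  have hHx : |H x| ≤ |H 0| + K * x := by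
    have := hH.dist_le_mul x 0
    rw [Real.dist_eq, Real.dist_eq, sub_zero, abs_of_pos hx] at this
    have h2 := abs_sub_abs_le_abs_sub (H x) (H 0)
    linarith
  rw [e, gG, Real.norm_eq_abs]
  have h3 : |r - l * x| ≤ |r| + l * x := by
    refine (abs_sub _ _).trans ?_
    rw [abs_of_pos (mul_pos hl hx)]
  calc |gA r l x * H x - (r - l * x) * gI r l H x|
      ≤ gA r l x * |H x| + |r - l * x| * |gI r l H x| := by
        refine (abs_sub _ _).trans ?_
        rw [abs_mul, abs_mul, abs_of_pos hA]
    _ ≤ gA r l x * (|H 0| + K * x) + (|r| + l * x) * (K / l * gA r l x) := by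
        gcongr
    _ = _ := by field_simp; ring

lemma gG_bound {r l : ℝ} (hr : 0 < r) {H : ℝ → ℝ} {K : NNReal} (hH : LipschitzWith K H)
    (hB : ∀ t, 0 < t → |l| * |gI r l H t| ≤ K * gA r l t) {x : ℝ} (hx : 0 < x) :
    |gG r l H x| ≤ 2 * max 1 (1 / r) * K * (x * gA r l x) := by
  have hA := gA_pos (r := r) (l := l) hx
  obtain ⟨s, hs0, hs1, hsr, hs⟩ : ∃ s : ℝ, 0 < s ∧ s ≤ 1 ∧ s ≤ r ∧ 1 / s = max 1 (1 / r) := by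
    rcases le_total 1 r with h | h
    · refine ⟨1, one_pos, le_rfl, h, ?_⟩
      rw [max_eq_left]; · simp
      rw [div_le_one hr]; exact h
    · refine ⟨r, hr, h, le_rfl, ?_⟩
      rw [max_eq_right]
      rw [le_div_iff₀ hr]; linarith
  have h1s : 1 ≤ 1 / s := by rw [hs]; exact le_max_left _ _
  rw [← hs]
  have hK : (0 : ℝ) ≤ K := K.2
  rcases le_total (l * x) (r + 2 / 3 * s) with hw | hw
  · have cG : Continuous (gG r l H) := by
      unfold gG
      exact ((gA_cont l hr).mul hH.continuous).sub
        ((by fun_prop : Continuous fun x => r - l * x).mul (gI_cont l hr hH.continuous))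
    have hG0 : gG r l H 0 = 0 := by simp [gG, gA_zero hr, gI_zero]
    have t1 : Tendsto (fun e => |gG r l H x - gG r l H e|) (𝓝[>] 0) (𝓝 |gG r l H x|) := by
      have : Continuous (fun e => |gG r l H x - gG r l H e|) := by fun_prop
      have := this.tendsto 0
      simp only [hG0, sub_zero] at this
      exact this.mono_left nhdsWithin_le_nhds
    refine le_of_tendsto t1 ?_
    filter_upwards [Ioo_mem_nhdsGT hx] with e he
    refine (gG_diff l hr hH hB he.1 he.2.le).trans ?_
    have h2 : ∫ t in e..x, gA r l t ≤ ∫ t in (0:ℝ)..x, gA r l t := by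
      refine intervalIntegral.integral_mono_interval he.1.le he.2.le le_rfl ?_
        ((gA_cont l hr).intervalIntegrable _ _)
      filter_upwards [ae_restrict_mem measurableSet_Ioc] with t ht
      exact (gA_pos ht.1).le
    have h3 := h2.trans (intA hr hs0 hs1 hsr hx hw)
    calc 2 * K * ∫ t in e..x, gA r l t ≤ 2 * K * (x * gA r l x) := by gcongr
      _ = 2 * 1 * K * (x * gA r l x) := by ring
      _ ≤ _ := by gcongr
  · have hl : 0 < l := by
      by_contra hl
      have : l * x ≤ 0 := mul_nonpos_of_nonpos_of_nonneg (not_lt.1 hl) hx.le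
      linarith
    have t1 : Tendsto (fun e => |gG r l H e - gG r l H x|) atTop (𝓝 |gG r l H x|) := by
      have := ((gG_top hl hH hB).sub_const (gG r l H x)).abs
      simpa using this
    refine le_of_tendsto t1 ?_
    filter_upwards [eventually_ge_atTop x] with e he
    refine (gG_diff l hr hH hB hx he).trans ?_
    have h3 := intB hr hs0 hs1 hsr hx he hw
    calc 2 * K * ∫ t in x..e, gA r l t ≤ 2 * K * (1 / s * (x * gA r l x)) := by gcongr
      _ = _ := by ring

lemma gF_lip {r l : ℝ} (hr : 0 < r) {H : ℝ → ℝ} {K : NNReal} (hH : LipschitzWith K H)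
    (hB : ∀ t, 0 < t → |l| * |gI r l H t| ≤ K * gA r l t) :
    LipschitzOnWith (Real.toNNReal (2 * max 1 (1 / r) * K)) (gF r l H) (Ici 0) := by
  rw [← closure_Ioi]
  refine LipschitzOnWith.closure ?_ ?_
  · rw [closure_Ioi]
    intro x hx
    rcases eq_or_lt_of_le (show 0 ≤ x from hx) with h | h
    · subst h; exact gF_tendsto l hr hH.continuous
    · exact (gF_deriv l hr hH.continuous h).continuousAt.continuousWithinAt
  · refine (convex_Ioi 0).lipschitzOnWith_of_nnnorm_hasDerivWithin_le
      (fun x hx => (gF_deriv l hr hH.continuous hx).hasDerivWithinAt) ?_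
    intro x hx
    have hx : 0 < x := hx
    have hA := gA_pos (r := r) (l := l) hx
    rw [gF_deriv' l hx]
    rw [← NNReal.coe_le_coe, coe_nnnorm, Real.coe_toNNReal _ (by positivity), Real.norm_eq_abs,
      abs_div, abs_of_pos (mul_pos hx hA), div_le_iff₀ (mul_pos hx hA)]
    exact gG_bound hr hH hB hx

lemma gF_bdd {r l : ℝ} (hr : 0 < r) (hl : l ≠ 0) {H : ℝ → ℝ} {K : NNReal} (hH : LipschitzWith K H)
    (hB : ∀ t, 0 < t → |l| * |gI r l H t| ≤ K * gA r l t) {x : ℝ} (hx : 0 ≤ x) :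
    |gF r l H x| ≤ |l|⁻¹ * K := by
  have hl' : 0 < |l| := abs_pos.2 hl
  have h1 : ∀ x, 0 < x → |gF r l H x| ≤ |l|⁻¹ * K := by
    intro x hx
    have hA := gA_pos (r := r) (l := l) hx
    simp only [gF, hx.ne', if_false]
    rw [abs_div, abs_of_pos hA, div_le_iff₀ hA, mul_assoc, le_inv_mul_iff₀ hl']
    exact hB x hx
  rcases eq_or_lt_of_le hx with h | h
  · subst h
    have := (gF_tendsto l hr hH.continuous).mono Ioi_subset_Ici_self
    refine le_of_tendsto this.abs ?_
    filter_upwards [self_mem_nhdsWithin] with t ht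
    exact h1 t ht
  · exact h1 x h

-- negative side bound
lemma hB_neg {r l : ℝ} (hr : 0 < r) (hl : l < 0) {H : ℝ → ℝ} (hc : Continuous H) {K : ℝ}
    (hH : ∀ t, 0 ≤ t → |l| * |H t| ≤ K * (r - l * t)) (x : ℝ) (hx : 0 < x) :
    |l| * |gI r l H x| ≤ K * gA r l x := by
  have h1 := gA_int l hr le_rfl hx.le
  rw [gA_zero hr, sub_zero] at h1
  rw [← h1, ← abs_mul, gI, ← intervalIntegral.integral_const_mul,
    ← intervalIntegral.integral_const_mul, ← Real.norm_eq_abs]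
  refine intervalIntegral.norm_integral_le_of_norm_le hx.le ?_
    ((gW_int l hr (by fun_prop) _ _).const_mul _)
  refine ae_of_all _ fun t ht => ?_
  have hw := gW_pos (r := r) (l := l) ht.1
  have := hH t ht.1.le
  rw [Real.norm_eq_abs, abs_mul, abs_mul, abs_of_pos hw]
  nlinarith

-- integrability on Ioi
lemma gW_intOn {r l : ℝ} (hr : 0 < r) (hl : 0 < l) : IntegrableOn (gW r l) (Ioi 0) := by
  have := integrableOn_rpow_mul_exp_neg_mul_rpow (p := 1) (s := r - 1) (b := l)
    (by linarith) one_pos hl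
  refine this.congr_fun (fun x _ => ?_) measurableSet_Ioi
  simp [gW]

lemma gHW_intOn {r l : ℝ} (hr : 0 < r) (hl : 0 < l) {H : ℝ → ℝ} {K : NNReal}
    (hH : LipschitzWith K H) : IntegrableOn (fun t => H t * gW r l t) (Ioi 0) := by
  have h1 := ((gW_intOn hr hl).const_mul |H 0|).add ((gW_intOn (r := r + 1) (by linarith) hl).const_mul (K:ℝ))
  refine Integrable.mono' h1 ?_ ?_
  · refine (hH.continuous.measurable.mul ?_).aestronglyMeasurable
    unfold gW; fun_prop
  · filter_upwards [ae_restrict_mem measurableSet_Ioi] with x hx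
    have hx : 0 < x := hx
    have hw := gW_pos (r := r) (l := l) hx
    have e : gW (r + 1) l x = x * gW r l x := by
      rw [← gA_eq hx]; simp [gA, gW]
    have hHx : |H x| ≤ |H 0| + K * x := by
      have := hH.dist_le_mul x 0
      rw [Real.dist_eq, Real.dist_eq, sub_zero, abs_of_pos hx] at this
      have h2 := abs_sub_abs_le_abs_sub (H x) (H 0)
      linarith
    simp only [Pi.add_apply]
    rw [e, Real.norm_eq_abs, abs_mul, abs_of_pos hw]
    nlinarith

lemma mean_id {r l : ℝ} (hr : 0 < r) (hl : 0 < l) :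
    ∫ t in Ioi (0:ℝ), (l * t - r) * gW r l t = 0 := by
  have h1 := integral_rpow_mul_exp_neg_mul_Ioi hr hl
  have h2 := integral_rpow_mul_exp_neg_mul_Ioi (a := r + 1) (by linarith) hl
  have e : ∫ t in Ioi (0:ℝ), (l * t - r) * gW r l t =
      ∫ t in Ioi (0:ℝ), (l * gW (r + 1) l t - r * gW r l t) := by
    refine setIntegral_congr_fun measurableSet_Ioi fun t ht => ?_
    have e : gW (r + 1) l t = t * gW r l t := by
      rw [← gA_eq ht]; simp [gA, gW]
    simp only [e]; ring
  rw [e, integral_sub ((gW_intOn (by linarith) hl).const_mul l) ((gW_intOn hr hl).const_mul r),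
    integral_const_mul, integral_const_mul]
  unfold gW
  rw [h1, h2, Gamma_add_one hr.ne', rpow_add_one (by positivity)]
  field_simp
  ring

lemma gI_nonpos {r l : ℝ} (hr : 0 < r) (hl : 0 < l) {k : ℝ → ℝ} (hc : Continuous k)
    (hk : Monotone k)
    (hi : IntegrableOn (fun t => k t * gW r l t) (Ioi 0))
    (h0 : ∫ t in Ioi (0:ℝ), k t * gW r l t = 0) {x : ℝ} (hx : 0 < x) : gI r l k x ≤ 0 := by
  rcases le_total (k x) 0 with h | h
  · unfold gI
    rw [intervalIntegral.integral_of_le hx.le]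
    refine setIntegral_nonpos measurableSet_Ioc fun t ht => ?_
    exact mul_nonpos_of_nonpos_of_nonneg ((hk ht.2).trans h) (gW_pos ht.1).le
  · have h1 : gI r l k x + ∫ t in Ioi x, k t * gW r l t = 0 := by
      rw [← h0, gI, intervalIntegral.integral_of_le hx.le, ← Ioc_union_Ioi_eq_Ioi hx.le,
        setIntegral_union (Ioc_disjoint_Ioi le_rfl) measurableSet_Ioi
        (hi.mono_set Ioc_subset_Ioi_self) (hi.mono_set (Ioi_subset_Ioi hx.le))]
    have h2 : 0 ≤ ∫ t in Ioi x, k t * gW r l t := by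
      refine setIntegral_nonneg measurableSet_Ioi fun t ht => ?_
      exact mul_nonneg (h.trans (hk (le_of_lt ht))) (gW_pos (hx.trans ht)).le
    linarith

lemma hB_pos1 {r l : ℝ} (hr : 0 < r) (hl : 0 < l) {H : ℝ → ℝ} {K : NNReal} (hH : LipschitzWith K H)
    (h0 : ∫ t in Ioi (0:ℝ), H t * gW r l t = 0) {x : ℝ} (hx : 0 < x) :
    l * gI r l H x ≤ K * gA r l x := by
  have hid : LipschitzWith (Real.toNNReal (l * K)) (fun t => (K:ℝ) * (l * t - r)) := by
    refine LipschitzWith.of_dist_le_mul fun a b => ?_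
    rw [Real.coe_toNNReal _ (by positivity), Real.dist_eq, Real.dist_eq,
      show (K:ℝ) * (l * a - r) - K * (l * b - r) = l * K * (a - b) by ring, abs_mul,
      abs_of_nonneg (by positivity : 0 ≤ l * K)]
  have i1 := gHW_intOn hr hl hH
  have i2 := gHW_intOn hr hl hid
  have hc := hH.continuous
  have key := gI_nonpos hr hl (k := fun t => l * H t + (K:ℝ) * (l * t - r)) (by fun_prop) ?_ ?_ ?_ hx
  · have e : gI r l (fun t => l * H t + (K:ℝ) * (l * t - r)) x = l * gI r l H x - K * gA r l x := by
      have h1 := gA_int l hr le_rfl hx.le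
      rw [gA_zero hr, sub_zero] at h1
      rw [← h1, gI, gI, ← intervalIntegral.integral_const_mul, ← intervalIntegral.integral_const_mul,
        ← intervalIntegral.integral_sub ((gW_int l hr hc _ _).const_mul _)
          ((gW_int l hr (by fun_prop) _ _).const_mul _)]
      congr 1; ext t; ring
    linarith
  · intro a b hab
    have := hH.dist_le_mul a b
    rw [Real.dist_eq, Real.dist_eq, abs_sub_comm a b, abs_of_nonneg (sub_nonneg.2 hab)] at this
    have := (abs_le.1 this).2
    simp only
    nlinarith
  · have i3 := (i1.const_mul l).add i2
    refine Integrable.congr i3 (ae_of_all _ fun t => ?_)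
    simp only [Pi.add_apply]; ring
  · have : ∀ t, (l * H t + (K:ℝ) * (l * t - r)) * gW r l t =
        l * (H t * gW r l t) + K * (l * t - r) * gW r l t := fun t => by ring
    simp_rw [this]
    rw [integral_add (i1.const_mul l) i2, integral_const_mul, h0]
    simp_rw [mul_assoc]
    rw [integral_const_mul, mean_id hr hl]; simp

lemma hB_pos {r l : ℝ} (hr : 0 < r) (hl : 0 < l) {H : ℝ → ℝ} {K : NNReal} (hH : LipschitzWith K H)
    (h0 : ∫ t in Ioi (0:ℝ), H t * gW r l t = 0) (x : ℝ) (hx : 0 < x) :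
    |l| * |gI r l H x| ≤ K * gA r l x := by
  rw [← abs_mul, abs_le']
  refine ⟨by simpa [abs_of_pos hl] using hB_pos1 hr hl hH h0 hx, ?_⟩
  have := hB_pos1 hr hl (H := fun t => - H t) (K := K) hH.neg (by simp [integral_neg, h0]) hx
  simpa [gI, abs_of_pos hl, intervalIntegral.integral_neg] using this

lemma lipConst_spec {h : ℝ → ℝ} (hLip : ∃ K : NNReal, LipschitzWith K h) :
    0 ≤ lipConst h ∧ LipschitzWith (Real.toNNReal (lipConst h)) h := by
  obtain ⟨K, hK⟩ := hLip
  have hb : BddAbove {c | ∃ x y : ℝ, x ≠ y ∧ c = |h x - h y| / |x - y|} := by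
    refine ⟨K, ?_⟩
    rintro c ⟨x, y, hxy, rfl⟩
    rw [div_le_iff₀ (abs_pos.2 (sub_ne_zero.2 hxy))]
    exact hK.dist_le_mul x y
  have h0 : 0 ≤ lipConst h := by
    refine Real.sSup_nonneg ?_
    rintro c ⟨x, y, hxy, rfl⟩
    positivity
  refine ⟨h0, LipschitzWith.of_dist_le_mul fun x y => ?_⟩
  rw [Real.coe_toNNReal _ h0, Real.dist_eq, Real.dist_eq]
  by_cases hxy : x = y
  · simp [hxy]
  · rw [← div_le_iff₀ (abs_pos.2 (sub_ne_zero.2 hxy))]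
    exact le_csSup hb ⟨x, y, hxy, rfl⟩

lemma mean_zero {r l : ℝ} (hr : 0 < r) (hl : 0 < l) {h : ℝ → ℝ} {K : NNReal}
    (hh : LipschitzWith K h) :
    ∫ t in Ioi (0:ℝ), (h t - ∫ y, h y ∂(gammaMeasure r l)) * gW r l t = 0 := by
  have hG := Gamma_pos_of_pos hr
  have e1 : ∫ y, h y ∂(gammaMeasure r l) = l ^ r / Gamma r * ∫ t in Ioi (0:ℝ), h t * gW r l t := by
    unfold gammaMeasure
    have hm : Measurable (gammaPDF r l) := (measurable_gammaPDFReal r l).ennreal_ofReal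
    rw [integral_withDensity_eq_integral_toReal_smul hm (ae_of_all _ fun x => by simp [gammaPDF])]
    have e2 : (fun x => (gammaPDF r l x).toReal • h x) =
        (Ici (0:ℝ)).indicator (fun x => l ^ r / Gamma r * (h x * gW r l x)) := by
      ext x
      rw [gammaPDF, ENNReal.toReal_ofReal (gammaPDFReal_nonneg hr hl x)]
      by_cases hx : 0 ≤ x
      · rw [indicator_of_mem (by exact hx)]
        simp only [gammaPDFReal, hx, if_true, gW, smul_eq_mul]; ring
      · rw [indicator_of_notMem (by exact hx)]
        simp [gammaPDFReal, hx]
    rw [e2, integral_indicator measurableSet_Ici, integral_Ici_eq_integral_Ioi, integral_const_mul]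
  have h1 := integral_rpow_mul_exp_neg_mul_Ioi hr hl
  have h1' : ∫ t in Ioi (0:ℝ), gW r l t = (1 / l) ^ r * Gamma r := h1
  simp_rw [sub_mul]
  rw [integral_sub (gHW_intOn hr hl hh) ((gW_intOn hr hl).const_mul _), integral_const_mul, h1', e1,
    div_rpow zero_le_one hl.le, one_rpow]
  have : 0 < l ^ r := by positivity
  field_simp
  ring

theorem gamma_stein_solution_exists_lipschitz
    (r lam : ℝ) (hr : 0 < r) (hlam : 0 < lam)
    (h : ℝ → ℝ) (hLip : ∃ K : NNReal, LipschitzWith K h) :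
    ∃ f : ℝ → ℝ,
      LipschitzWith (Real.toNNReal (2 * max 1 (1 / r) * lipConst h)) f ∧
      (∀ x : ℝ, DifferentiableAt ℝ f x →
        x * deriv f x + (r - lam * x) * f x
          = h x - ∫ y, h y ∂(gammaMeasure r lam)) ∧
      (∀ x : ℝ, |f x| ≤ lam⁻¹ * lipConst h) := by
  obtain ⟨hL0, hL⟩ := lipConst_spec hLip
  have hm := mean_zero hr hlam hL
  set c := ∫ y, h y ∂(gammaMeasure r lam) with hc
  set K := Real.toNNReal (lipConst h) with hK
  have hKc : (K : ℝ) = lipConst h := Real.coe_toNNReal _ hL0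
  rw [← hKc]
  set H : ℝ → ℝ := fun t => h t - c with hHdef
  have hH : LipschitzWith K H := LipschitzWith.of_dist_le_mul fun x y => by
    simpa [hHdef] using hL.dist_le_mul x y
  have hB := hB_pos hr hlam hH hm
  set H' : ℝ → ℝ := fun t => H (-t) with hH'def
  have hH' : LipschitzWith K H' := LipschitzWith.of_dist_le_mul fun x y => by
    simpa [hH'def] using hH.dist_le_mul (-x) (-y)
  have hB' : ∀ t, 0 < t → |(-lam)| * |gI r (-lam) H' t| ≤ K * gA r (-lam) t := by
    refine hB_neg hr (by linarith) hH'.continuous ?_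
    intro t ht
    have h1 := gF_bdd hr hlam.ne' hH hB le_rfl
    simp only [gF, if_true] at h1
    rw [abs_div, abs_of_pos hr, abs_of_pos hlam, div_le_iff₀ hr, mul_assoc,
      le_inv_mul_iff₀ hlam] at h1
    have h2 := hH.dist_le_mul (-t) 0
    rw [Real.dist_eq, Real.dist_eq, sub_zero, abs_neg, abs_of_nonneg ht] at h2
    have h3 := abs_sub_abs_le_abs_sub (H (-t)) (H 0)
    rw [abs_neg, abs_of_pos hlam]
    simp only [hH'def]
    nlinarith
  have lp := gF_lip hr hH hB
  have ln := gF_lip hr hH' hB'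
  set C := Real.toNNReal (2 * max 1 (1 / r) * K) with hC
  set f : ℝ → ℝ := fun x => if 0 ≤ x then gF r lam H x else gF r (-lam) H' (-x) with hf
  have fp : ∀ x, 0 ≤ x → f x = gF r lam H x := fun x hx => by simp [hf, hx]
  have fn : ∀ x, x ≤ 0 → f x = gF r (-lam) H' (-x) := by
    intro x hx
    rcases eq_or_lt_of_le hx with h | h
    · subst h; simp [hf, gF, hH'def]
    · simp [hf, not_le.2 h]
  refine ⟨f, ?_, ?_, ?_⟩
  · have Lp : ∀ x y, 0 ≤ x → x ≤ y → |f x - f y| ≤ C * (y - x) := by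
      intro x y hx hxy
      have := lp.dist_le_mul x hx y (hx.trans hxy)
      rwa [Real.dist_eq, Real.dist_eq, abs_sub_comm x y, abs_of_nonneg (sub_nonneg.2 hxy),
        ← fp x hx, ← fp y (hx.trans hxy)] at this
    have Ln : ∀ x y, y ≤ 0 → x ≤ y → |f x - f y| ≤ C * (y - x) := by
      intro x y hy hxy
      have := ln.dist_le_mul (-x) (by simp; linarith) (-y) (by simpa using hy)
      rwa [Real.dist_eq, Real.dist_eq, show -x - -y = y - x by ring,
        abs_of_nonneg (sub_nonneg.2 hxy), ← fn x (hxy.trans hy), ← fn y hy] at this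
    have La : ∀ x y, x ≤ y → |f x - f y| ≤ C * (y - x) := by
      intro x y hxy
      rcases le_total 0 x with hx | hx
      · exact Lp x y hx hxy
      rcases le_total y 0 with hy | hy
      · exact Ln x y hy hxy
      have h1 := Ln x 0 le_rfl hx
      have h2 := Lp 0 y le_rfl hy
      have h3 := abs_sub_le (f x) (f 0) (f y)
      linarith
    refine LipschitzWith.of_dist_le_mul fun x y => ?_
    rw [Real.dist_eq, Real.dist_eq]
    rcases le_total x y with hxy | hxy
    · rw [abs_sub_comm x y, abs_of_nonneg (sub_nonneg.2 hxy)]; exact La x y hxy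
    · rw [abs_sub_comm (f x), abs_of_nonneg (sub_nonneg.2 hxy)]; exact La y x hxy
  · intro x _
    rcases lt_trichotomy x 0 with hx | hx | hx
    · have hx' : 0 < -x := by linarith
      have h1 : HasDerivAt (fun y => gF r (-lam) H' (-y))
          ((H' (-x) - (r - (-lam) * (-x)) * gF r (-lam) H' (-x)) / (-x) * (-1)) x :=
        HasDerivAt.comp x (h := fun y : ℝ => -y) (gF_deriv (-lam) hr hH'.continuous hx')
          (hasDerivAt_neg x)
      have h2 : f =ᶠ[𝓝 x] fun y => gF r (-lam) H' (-y) := by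
        filter_upwards [gt_mem_nhds hx] with t ht
        exact fn t ht.le
      rw [(h1.congr_of_eventuallyEq h2).deriv, fn x hx.le]
      have : H' (-x) = h x - c := by simp [hH'def, hHdef]
      rw [this]
      have := hx.ne
      field_simp
      ring
    · subst hx
      rw [fp 0 le_rfl]
      simp only [gF, if_true, hHdef]
      field_simp
      ring
    · have h2 : f =ᶠ[𝓝 x] gF r lam H := by
        filter_upwards [lt_mem_nhds hx] with t ht
        exact fp t ht.le
      rw [((gF_deriv lam hr hH.continuous hx).congr_of_eventuallyEq h2).deriv, fp x hx.le]
      simp only [hHdef]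
      field_simp
      ring
  · intro x
    rcases le_total 0 x with hx | hx
    · rw [fp x hx]
      simpa [abs_of_pos hlam] using gF_bdd hr hlam.ne' hH hB hx
    · rw [fn x hx]
      simpa [abs_of_pos hlam] using
        gF_bdd hr (neg_ne_zero.2 hlam.ne') hH' hB' (x := -x) (by linarith)
end

section
/- Let r, λ > 0 and let h : ℝ → ℝ be continuously differentiable with both h and h' Lipschitz-continuous. Then the Lipschitz-continuous bounded solution f_h on ℝ of the Gamma Stein equation x f'(x) + (r − λx) f(x) = h(x) − E[h(X_{r,λ})] is continuously differentiable on ℝ and its derivative f_h' is Lipschitz-continuous with minimum Lipschitz constant ‖f_h''‖ ≤ 4λ·max(1, 1/r)·‖h'‖ + 2‖h''‖. -/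
open MeasureTheory ProbabilityTheory Real

lemma W_deriv (r a : ℝ) (z : ℝ → ℝ) (zd s : ℝ) (hs : 0 < s) (hz : HasDerivAt z zd s) :
    HasDerivAt (fun s => s ^ r * exp (a * s) * z s)
      (s ^ r * exp (a * s) / s * (s * zd + (r + a * s) * z s)) s := by
  have h1 : HasDerivAt (fun s : ℝ => s ^ r) (r * s ^ (r - 1)) s :=
    Real.hasDerivAt_rpow_const (Or.inl hs.ne')
  have h2 : HasDerivAt (fun s : ℝ => exp (a * s)) (exp (a * s) * (a * 1)) s :=
    ((hasDerivAt_id s).const_mul a).exp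
  have h3 := (h1.mul h2).mul hz
  refine h3.congr_deriv ?_
  rw [Real.rpow_sub_one hs.ne']
  simp only [Pi.mul_apply]
  field_simp
  ring

lemma left_cmp (r a M x0 : ℝ) (hr : 0 < r) (hx : 0 < x0) (z zd : ℝ → ℝ)
    (hM : ∀ s, 0 < s → s ≤ x0 → |z s| ≤ M)
    (hz : ∀ s, 0 < s → HasDerivAt z (zd s) s)
    (hi : ∀ s, 0 < s → s ≤ x0 → 0 ≤ s * zd s + (r + a * s) * z s) : 0 ≤ z x0 := by
  have hmono : MonotoneOn (fun s => s ^ r * exp (a * s) * z s) (Set.Ioc 0 x0) := by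
    apply monotoneOn_of_deriv_nonneg (convex_Ioc 0 x0)
    · intro s hs
      exact (W_deriv r a z _ s hs.1 (hz s hs.1)).continuousAt.continuousWithinAt
    · intro s hs
      rw [interior_Ioc] at hs
      exact (W_deriv r a z _ s hs.1 (hz s hs.1)).differentiableAt.differentiableWithinAt
    · intro s hs
      rw [interior_Ioc] at hs
      rw [(W_deriv r a z _ s hs.1 (hz s hs.1)).deriv]
      have := hi s hs.1 hs.2.le
      have := hs.1
      positivity
  have hlim : Filter.Tendsto (fun s => s ^ r * exp (a * s) * z s) (nhdsWithin 0 (Set.Ioi 0)) (nhds 0) := by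
    have h0 : Filter.Tendsto (fun s : ℝ => s ^ r * exp (a * s)) (nhdsWithin 0 (Set.Ioi 0)) (nhds 0) := by
      have : Continuous (fun s : ℝ => s ^ r * exp (a * s)) :=
        (Real.continuous_rpow_const hr.le).mul (by fun_prop)
      have h := this.tendsto 0
      simp only [Real.zero_rpow hr.ne', zero_mul] at h
      exact h.mono_left nhdsWithin_le_nhds
    refine h0.zero_mul_isBoundedUnder_le ?_
    refine ⟨M, ?_⟩
    rw [Filter.eventually_map]
    filter_upwards [Ioc_mem_nhdsGT hx] with s hs
    exact hM s hs.1 hs.2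
  have hle : 0 ≤ x0 ^ r * exp (a * x0) * z x0 := by
    refine le_of_tendsto hlim ?_
    filter_upwards [Ioc_mem_nhdsGT hx] with s hs
    exact hmono hs ⟨hx, le_rfl⟩ hs.2
  have : 0 < x0 ^ r * exp (a * x0) := by positivity
  exact nonneg_of_mul_nonneg_right hle this

lemma right_cmp (r lam M x0 : ℝ) (hl : 0 < lam) (hx : 0 < x0) (z zd : ℝ → ℝ)
    (hM : ∀ s, |z s| ≤ M)
    (hz : ∀ s, 0 < s → HasDerivAt z (zd s) s)
    (hi : ∀ s, x0 ≤ s → s * zd s + (r - lam * s) * z s ≤ 0) : 0 ≤ z x0 := by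
  have hmono : AntitoneOn (fun s => s ^ r * exp (-lam * s) * z s) (Set.Ici x0) := by
    apply antitoneOn_of_deriv_nonpos (convex_Ici x0)
    · intro s hs
      have hs0 := hx.trans_le hs
      exact (W_deriv r _ z _ s hs0 (hz s hs0)).continuousAt.continuousWithinAt
    · intro s hs
      rw [interior_Ici] at hs
      have hs0 := hx.trans hs
      exact (W_deriv r _ z _ s hs0 (hz s hs0)).differentiableAt.differentiableWithinAt
    · intro s hs
      rw [interior_Ici] at hs
      have hs0 := hx.trans hs
      rw [(W_deriv r _ z _ s hs0 (hz s hs0)).deriv]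
      have := hi s (le_of_lt hs)
      exact mul_nonpos_of_nonneg_of_nonpos (by positivity) (by linarith)
  have hlim : Filter.Tendsto (fun s => s ^ r * exp (-lam * s) * z s) Filter.atTop (nhds 0) := by
    refine (tendsto_rpow_mul_exp_neg_mul_atTop_nhds_zero r lam hl).zero_mul_isBoundedUnder_le ?_
    exact ⟨M, by simp [hM]⟩
  have hle : 0 ≤ x0 ^ r * exp (-lam * x0) * z x0 := by
    refine le_of_tendsto hlim ?_
    filter_upwards [Filter.eventually_ge_atTop x0] with s hs
    exact hmono (Set.self_mem_Ici) hs hs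
  have : 0 < x0 ^ r * exp (-lam * x0) := by positivity
  exact nonneg_of_mul_nonneg_right hle this

/-- data for the half-line equation with sign `a` -/
structure HL (r a L M : ℝ) (f fd k : ℝ → ℝ) : Prop where
  bd : ∀ s, |f s| ≤ M
  der : ∀ s, 0 < s → HasDerivAt f (fd s) s
  eq : ∀ s, 0 < s → s * fd s + (r + a * s) * f s = k s
  lip : ∀ s t, |k s - k t| ≤ L * |s - t|

lemma HL.neg {r a L M : ℝ} {f fd k : ℝ → ℝ} (H : HL r a L M f fd k) :
    HL r a L M (fun s => - f s) (fun s => - fd s) (fun s => - k s) where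
  bd s := by simpa using H.bd s
  der s hs := (H.der s hs).neg
  eq s hs := by have := H.eq s hs; linarith
  lip s t := by
    have := H.lip s t
    rwa [← abs_neg, show -(-k s - -k t) = k s - k t by ring]

lemma HL.lip' {r a L M : ℝ} {f fd k : ℝ → ℝ} (H : HL r a L M f fd k) {s t : ℝ} (hst : s ≤ t) :
    k s ≤ k t + L * (t - s) ∧ k t ≤ k s + L * (t - s) := by
  have h := H.lip t s
  rw [abs_of_nonneg (sub_nonneg.2 hst), abs_le] at h
  constructor <;> linarith

lemma HL.ge_lin {r a L M : ℝ} {f fd k : ℝ → ℝ} (H : HL r a L M f fd k) (hr : 0 < r)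
    {x0 : ℝ} (hx : 0 < x0) (b c : ℝ)
    (hb : ∀ s, 0 < s → s ≤ x0 → s * c + (r + a * s) * (b + c * s) ≤ k s) :
    b + c * x0 ≤ f x0 := by
  have := left_cmp r a (M + (|b| + |c| * x0)) x0 hr hx (fun s => f s - (b + c * s))
    (fun s => fd s - c) ?_ ?_ ?_
  · simpa using this
  · intro s hs hs1
    calc |f s - (b + c * s)| ≤ |f s| + |b + c * s| := abs_sub _ _
      _ ≤ |f s| + (|b| + |c * s|) := by gcongr; exact abs_add_le _ _
      _ ≤ _ := by rw [abs_mul, abs_of_pos hs]; gcongr; exact H.bd s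
  · intro s hs
    have h1 : HasDerivAt (fun s : ℝ => b + c * s) (c * 1) s :=
      ((hasDerivAt_id s).const_mul c).const_add b
    rw [mul_one] at h1
    exact (H.der s hs).sub h1
  · intro s hs hs1
    have h1 := H.eq s hs
    have h2 := hb s hs hs1
    nlinarith

lemma HL.L_nonneg {r a L M : ℝ} {f fd k : ℝ → ℝ} (H : HL r a L M f fd k) : 0 ≤ L := by
  have := H.lip 1 0
  simp at this
  exact (abs_nonneg _).trans this

lemma HL.ge_pos {r lam L M : ℝ} {f fd k : ℝ → ℝ} (H : HL r (-lam) L M f fd k) (hr : 0 < r)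
    (hl : 0 < lam) {x0 : ℝ} (hx : 0 < x0) : -(L / lam) ≤ f x0 := by
  obtain ⟨B, hB⟩ : ∃ B, B = L / lam := ⟨_, rfl⟩
  have hL : L = lam * B := by rw [hB]; field_simp
  rw [← hB]
  rcases le_total 0 (k x0 - L * x0 + r * B) with hc | hc
  · have := H.ge_lin hr hx (-B) 0 ?_
    · simpa using this
    · intro s hs hs1
      have := (H.lip' hs1).2
      nlinarith
  · have := right_cmp r lam (M + |B|) x0 hl hx (fun s => f s + B) fd ?_ ?_ ?_
    · linarith
    · intro s
      exact (abs_add_le _ _).trans (by have := H.bd s; linarith)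
    · intro s hs
      exact (H.der s hs).add_const B
    · intro s hs
      have := (H.lip' hs).2
      have := H.eq s (hx.trans_le hs)
      nlinarith

lemma HL.le_pos {r lam L M : ℝ} {f fd k : ℝ → ℝ} (H : HL r (-lam) L M f fd k) (hr : 0 < r)
    (hl : 0 < lam) {x0 : ℝ} (hx : 0 < x0) : f x0 ≤ L / lam := by
  have := H.neg.ge_pos hr hl hx
  linarith

lemma HL.k0_le {r lam L M : ℝ} {f fd k : ℝ → ℝ} (H : HL r (-lam) L M f fd k) (hr : 0 < r)
    (hl : 0 < lam) : lam * k 0 ≤ r * L := by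
  by_contra hcon
  push Not at hcon
  obtain ⟨B, hB⟩ : ∃ B, B = k 0 / r := ⟨_, rfl⟩
  have hk : k 0 = r * B := by rw [hB]; field_simp
  have hB1 : L < lam * B := by
    rw [hk] at hcon
    nlinarith
  have h1 := H.le_pos hr hl one_pos
  have h2 := H.ge_lin hr one_pos B 0 ?_
  · have : B ≤ L / lam := by simpa using h2.trans h1
    rw [le_div_iff₀ hl] at this
    linarith
  · intro s hs _
    have := (H.lip' hs.le).1
    nlinarith

lemma HL.slope_pos {r lam L M : ℝ} {f fd k : ℝ → ℝ} (H : HL r (-lam) L M f fd k) (hr : 0 < r)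
    (hl : 0 < lam) {x0 : ℝ} (hx : 0 < x0) : fd x0 ≤ 2 * L := by
  have hk0 := H.k0_le hr hl
  have heq := H.eq x0 hx
  have hlp := (H.lip' hx.le).2
  have hle := H.le_pos hr hl hx
  have hge := H.ge_pos hr hl hx
  obtain ⟨B, hB⟩ : ∃ B, B = L / lam := ⟨_, rfl⟩
  have hL : L = lam * B := by rw [hB]; field_simp
  rw [← hB] at hle hge
  have hk1 : k 0 ≤ r * B := by
    rw [hL] at hk0
    nlinarith
  suffices x0 * fd x0 ≤ x0 * (2 * L) from le_of_mul_le_mul_left this hx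
  rcases le_total r (lam * x0) with hc | hc
  · nlinarith [mul_nonneg (sub_nonneg.2 hc) (sub_nonneg.2 hle)]
  · obtain ⟨b, hb⟩ : ∃ b, b = (k x0 - L * x0) / r := ⟨_, rfl⟩
    have hkb : k x0 = L * x0 + r * b := by rw [hb]; field_simp; ring
    have hbB : b ≤ B := by nlinarith
    rcases le_total b (-B) with hd | hd
    · nlinarith [mul_nonneg (sub_nonneg.2 hc) (by linarith : 0 ≤ f x0 + B),
        mul_nonneg hr.le (by linarith : 0 ≤ -B - b), H.L_nonneg]
    · have h2 := H.ge_lin hr hx b 0 ?_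
      · have h3 : b ≤ f x0 := by simpa using h2
        nlinarith [mul_nonneg (sub_nonneg.2 hc) (sub_nonneg.2 h3),
          mul_nonneg (mul_pos hl hx).le (sub_nonneg.2 hbB)]
      · intro s hs hs1
        have := (H.lip' hs1).2
        nlinarith [mul_nonneg (mul_pos hl hs).le (by linarith : 0 ≤ b + B)]

lemma HL.slope_neg {r lam L M : ℝ} {f fd k : ℝ → ℝ} (H : HL r lam L M f fd k) (hr : 0 < r)
    (hl : 0 < lam) (hk0 : lam * k 0 ≤ r * L) (hk0' : - (r * L) ≤ lam * k 0)
    {x0 : ℝ} (hx : 0 < x0) : fd x0 ≤ 2 * L / r := by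
  have heq := H.eq x0 hx
  have hlp := H.lip' hx.le
  have hL0 := H.L_nonneg
  obtain ⟨b, hb⟩ : ∃ b, b = (k x0 - L * x0) / r := ⟨_, rfl⟩
  have hkb : k x0 = L * x0 + r * b := by rw [hb]; field_simp; ring
  have hlx := mul_pos hl hx
  have hD : 0 < r + 1 + lam * x0 := by positivity
  obtain ⟨c, hc⟩ : ∃ c, c = (L - lam * b) / (r + 1 + lam * x0) := ⟨_, rfl⟩
  have hcD : c * (r + 1 + lam * x0) = L - lam * b := by rw [hc]; field_simp
  have hbL : lam * b ≤ L := by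
    have : r * (lam * b) ≤ r * L := by nlinarith
    exact le_of_mul_le_mul_left this hr
  have hc0 : 0 ≤ c := by rw [hc]; apply div_nonneg _ hD.le; linarith
  have h2 := H.ge_lin hr hx b c ?_
  · have h3 : x0 * fd x0 ≤ x0 * c := by
      have : 0 ≤ (r + lam * x0) * (f x0 - (b + c * x0)) := by
        apply mul_nonneg (by positivity); linarith
      nlinarith
    refine (le_of_mul_le_mul_left h3 hx).trans ?_
    rw [le_div_iff₀ hr]
    have h4 : r * (L - lam * b) ≤ 2 * L * (r + lam * x0) := by
      have := mul_le_mul_of_nonneg_left hlp.1 hl.le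
      nlinarith
    have h5 : (c * r) * (r + 1 + lam * x0) ≤ (2 * L) * (r + 1 + lam * x0) := by
      nlinarith
    exact le_of_mul_le_mul_right h5 hD
  · intro s hs hs1
    have := (H.lip' hs1).2
    have h6 : 0 ≤ (lam * c * s) * (x0 - s) := by
      apply mul_nonneg (by positivity); linarith
    nlinarith

lemma full_bound {r lam L M m : ℝ} {f fd k : ℝ → ℝ} (hr : 0 < r) (hl : 0 < lam)
    (hm1 : 1 ≤ m) (hmr : 1 / r ≤ m) (bd : ∀ s, |f s| ≤ M)
    (der : ∀ s, s ≠ 0 → HasDerivAt f (fd s) s)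
    (eq : ∀ s, s ≠ 0 → s * fd s + (r - lam * s) * f s = k s)
    (lip : ∀ s t, |k s - k t| ≤ L * |s - t|) : ∀ x, x ≠ 0 → |fd x| ≤ 2 * m * L := by
  have H : HL r (-lam) L M f fd k :=
    ⟨bd, fun s hs => der s hs.ne', fun s hs => by have := eq s hs.ne'; linarith, lip⟩
  have H' : HL r lam L M (fun y => f (-y)) (fun y => -fd (-y)) (fun y => k (-y)) := by
    refine ⟨fun s => bd _, fun s hs => ?_, fun s hs => ?_, fun s t => ?_⟩
    · have h1 := der (-s) (by simpa using hs.ne')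
      have h2 := HasDerivAt.comp s h1 (hasDerivAt_neg s)
      simpa [Function.comp_def] using h2
    · have := eq (-s) (by simpa using hs.ne')
      linarith
    · have := lip (-s) (-t)
      rwa [show |(-s) - (-t)| = |s - t| by rw [← abs_neg]; congr 1; ring] at this
  have hk1 := H.k0_le hr hl
  have hk2 := H.neg.k0_le hr hl
  have hL := H.L_nonneg
  have hA : 2 * L ≤ 2 * m * L := by nlinarith
  have hB : 2 * L / r ≤ 2 * m * L := by
    rw [div_eq_mul_one_div]
    nlinarith [mul_le_mul_of_nonneg_left hmr hL]
  intro x hx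
  rw [abs_le]
  rcases lt_or_gt_of_ne hx with hx | hx
  · have hx' : 0 < -x := by linarith
    have h1 := H'.slope_neg hr hl (by simpa using hk1) (by rw [neg_zero]; linarith) hx'
    have h2 := H'.neg.slope_neg hr hl (by simp only [neg_zero]; linarith)
      (by simp only [neg_zero]; linarith) hx'
    simp only [neg_neg] at h1 h2
    constructor <;> linarith
  · have h1 := H.slope_pos hr hl hx
    have h2 := H.neg.slope_pos hr hl hx
    constructor <;> linarith

lemma reg_off_zero {f φ : ℝ → ℝ} {K : NNReal} (hf : LipschitzWith K f)
    (hφ : ContinuousOn φ {0}ᶜ)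
    (hd : ∀ x, x ≠ 0 → DifferentiableAt ℝ f x → deriv f x = φ x) :
    ∀ x, x ≠ 0 → HasDerivAt f (φ x) x := by
  intro x0 hx0
  have hev : ∀ᶠ y in nhds x0, f y = f x0 + ∫ t in x0..y, φ t := by
    filter_upwards [Metric.ball_mem_nhds x0 (abs_pos.2 hx0)] with y hy
    have hsub : ∀ t ∈ Set.uIcc x0 y, t ≠ 0 := by
      intro t ht h0
      subst h0
      have h1 := Set.abs_sub_left_of_mem_uIcc ht
      rw [Metric.mem_ball, Real.dist_eq] at hy
      rw [zero_sub, abs_neg] at h1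
      linarith
    have h1 := (hf.lipschitzOnWith (s := Set.uIcc x0 y)).absolutelyContinuousOnInterval.integral_deriv_eq_sub
    have h2 : ∫ t in x0..y, deriv f t = ∫ t in x0..y, φ t := by
      apply intervalIntegral.integral_congr_ae
      filter_upwards [hf.ae_differentiableAt_real] with t ht hm
      exact hd t (hsub t (Set.uIoc_subset_uIcc hm)) ht
    linarith
  have hopen : IsOpen ({0}ᶜ : Set ℝ) := isOpen_compl_singleton
  have hI : HasDerivAt (fun y => ∫ t in x0..y, φ t) (φ x0) x0 :=
    intervalIntegral.integral_hasDerivAt_right (by simp)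
      (hφ.stronglyMeasurableAtFilter hopen x0 hx0) (hφ.continuousAt (hopen.mem_nhds hx0))
  exact (hI.const_add (f x0)).congr_of_eventuallyEq hev

lemma lip_of_bound_off_zero {g gd : ℝ → ℝ} {C : ℝ} (hg : Continuous g)
    (hd : ∀ x, x ≠ 0 → HasDerivAt g (gd x) x) (hb : ∀ x, x ≠ 0 → |gd x| ≤ C) :
    ∀ x y, |g x - g y| ≤ C * |x - y| := by
  have key : ∀ x y, x < y → (0 ≤ x ∨ y ≤ 0) → |g y - g x| ≤ C * (y - x) := by
    intro x y hxy h0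
    have hne : ∀ t ∈ Set.Ioo x y, t ≠ 0 := by
      rintro t ⟨h1, h2⟩ rfl
      rcases h0 with h | h <;> linarith
    obtain ⟨c, hc, hs⟩ := exists_hasDerivAt_eq_slope g gd hxy hg.continuousOn
      (fun t ht => hd t (hne t ht))
    have h1 := hb c (hne c hc)
    have hp : 0 < y - x := by linarith
    rw [hs, abs_div, abs_of_pos hp, div_le_iff₀ hp] at h1
    exact h1
  have key2 : ∀ x y, x < y → |g y - g x| ≤ C * (y - x) := by
    intro x y hxy
    by_cases h0 : 0 ≤ x ∨ y ≤ 0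
    · exact key x y hxy h0
    · push Not at h0
      have h1 := key x 0 h0.1 (Or.inr le_rfl)
      have h2 := key 0 y h0.2 (Or.inl le_rfl)
      have h3 := abs_sub_le (g y) (g 0) (g x)
      linarith
  intro x y
  rcases lt_trichotomy x y with h | h | h
  · rw [abs_sub_comm, abs_sub_comm x y, abs_of_pos (sub_pos.2 h)]; exact key2 x y h
  · simp [h]
  · rw [abs_of_pos (sub_pos.2 h)]; exact key2 y x h

lemma lipConst_spec_s1 {g : ℝ → ℝ} (hg : ∃ K : NNReal, LipschitzWith K g) :
    ∀ x y, |g x - g y| ≤ lipConst g * |x - y| := by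
  obtain ⟨K, hK⟩ := hg
  intro x y
  rcases eq_or_ne x y with rfl | hxy
  · simp
  have hp : 0 < |x - y| := abs_pos.2 (sub_ne_zero.2 hxy)
  rw [← div_le_iff₀ hp]
  refine le_csSup ⟨K, ?_⟩ ⟨x, y, hxy, rfl⟩
  rintro c ⟨u, v, huv, rfl⟩
  have hp : 0 < |u - v| := abs_pos.2 (sub_ne_zero.2 huv)
  rw [div_le_iff₀ hp]
  have := hK.dist_le_mul u v
  simpa [Real.dist_eq] using this

theorem gamma_stein_solution_C1_second_bound
    (r lam : ℝ) (hr : 0 < r) (hlam : 0 < lam)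
    (h : ℝ → ℝ) (hC1 : ContDiff ℝ 1 h)
    (hLip : ∃ K : NNReal, LipschitzWith K h)
    (hLip' : ∃ K : NNReal, LipschitzWith K (deriv h))
    (f : ℝ → ℝ)
    (hfLip : ∃ K : NNReal, LipschitzWith K f)
    (hfBdd : ∃ M : ℝ, ∀ x : ℝ, |f x| ≤ M)
    (hfSol : ∀ x : ℝ, DifferentiableAt ℝ f x →
      x * deriv f x + (r - lam * x) * f x
        = h x - ∫ y, h y ∂(gammaMeasure r lam)) :
    ContDiff ℝ 1 f ∧
      LipschitzWith
        (Real.toNNReal (4 * lam * max 1 (1 / r) * lipConst h + 2 * lipConst (deriv h)))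
        (deriv f) := by
  obtain ⟨I, hI⟩ : ∃ I, I = ∫ y, h y ∂(gammaMeasure r lam) := ⟨_, rfl⟩
  rw [← hI] at hfSol
  obtain ⟨M, hM⟩ := hfBdd
  obtain ⟨K, hK⟩ := hfLip
  have hfc : Continuous f := hK.continuous
  have hhd : ∀ x, HasDerivAt h (deriv h x) x := fun x =>
    (hC1.differentiable (by norm_num) x).hasDerivAt
  have hhc : Continuous h := hC1.continuous
  set φ : ℝ → ℝ := fun x => (h x - I - (r - lam * x) * f x) / x with hφ
  have hd1 : ∀ x, x ≠ 0 → HasDerivAt f (φ x) x := by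
    apply reg_off_zero hK
    · refine ContinuousOn.div (by fun_prop) (by fun_prop) (fun x hx => hx)
    · intro x hx hdx
      have := hfSol x hdx
      simp only [hφ]
      rw [eq_div_iff hx]
      linarith
  set m := max 1 (1 / r) with hm
  have hf' : ∀ x, x ≠ 0 → |φ x| ≤ 2 * m * lipConst h := by
    apply full_bound (k := fun x => h x - I) hr hlam (le_max_left _ _) (le_max_right _ _) hM hd1
    · intro s hs
      simp only [hφ]
      field_simp
      ring
    · intro s t
      have := lipConst_spec_s1 hLip s t
      simpa using this
  have hfL := lip_of_bound_off_zero hfc hd1 hf'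
  -- derivative of φ
  set φd : ℝ → ℝ := fun x => (deriv h x + lam * f x - (r + 1 - lam * x) * φ x) / x with hφd
  have hd2 : ∀ x, x ≠ 0 → HasDerivAt φ (φd x) x := by
    intro x hx
    have h1 : HasDerivAt (fun x : ℝ => r - lam * x) (-(lam * 1)) x :=
      ((hasDerivAt_id x).const_mul lam).const_sub r
    have h2 := (((hhd x).sub_const I).sub (h1.mul (hd1 x hx))).div (hasDerivAt_id x) hx
    refine h2.congr_deriv ?_
    simp only [hφd, hφ, Pi.mul_apply, Pi.sub_apply, id]
    field_simp
    ring
  set c : ℝ := (deriv h 0 + lam * f 0) / (r + 1) with hc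
  set g : ℝ → ℝ := Function.update φ 0 c with hg
  have hgφ : ∀ x, x ≠ 0 → g x = φ x := fun x hx => by simp [hg, hx]
  have hdg : ∀ x, x ≠ 0 → HasDerivAt g (φd x) x := by
    intro x hx
    refine (hd2 x hx).congr_of_eventuallyEq ?_
    filter_upwards [isOpen_compl_singleton.mem_nhds hx] with y hy
    exact hgφ y hy
  set L2 := lipConst (deriv h) + lam * (2 * m * lipConst h) with hL2
  have hgb : ∀ x, x ≠ 0 → |φd x| ≤ 2 * 1 * L2 := by
    refine full_bound (f := g) (k := fun x => deriv h x + lam * f x) (r := r + 1) (by linarith) hlam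
      le_rfl ?_ (M := 2 * m * lipConst h + |c|) ?_ hdg ?_ ?_
    · rw [div_le_iff₀ (by linarith)]; linarith
    · intro s
      by_cases hs : s = 0
      · subst hs
        have := (abs_nonneg _).trans (hf' 1 one_ne_zero)
        simp only [hg, Function.update_self]
        linarith
      · rw [hgφ s hs]
        have := hf' s hs
        have := abs_nonneg c
        linarith
    · intro s hs
      rw [hgφ s hs]
      simp only [hφd]
      field_simp
      ring
    · intro s t
      have h1 := lipConst_spec_s1 hLip' s t
      have h2 := mul_le_mul_of_nonneg_left (hfL s t) hlam.le
      rw [show deriv h s + lam * f s - (deriv h t + lam * f t)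
        = (deriv h s - deriv h t) + lam * (f s - f t) by ring]
      refine (abs_add_le _ _).trans ?_
      rw [abs_mul, abs_of_pos hlam, hL2]
      linarith
  have hdhc : Continuous (deriv h) := hC1.continuous_deriv le_rfl
  -- continuity at zero
  have hg0 : ContinuousAt g 0 := by
    rw [hg, continuousAt_update_same]
    have hb : Filter.Tendsto (fun x : ℝ => x * φd x) (nhdsWithin 0 {0}ᶜ) (nhds 0) := by
      have h0 : Filter.Tendsto (fun x : ℝ => x) (nhdsWithin 0 {0}ᶜ) (nhds 0) :=
        Filter.tendsto_id.mono_left nhdsWithin_le_nhds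
      refine h0.zero_mul_isBoundedUnder_le ⟨2 * 1 * L2, ?_⟩
      rw [Filter.eventually_map]
      filter_upwards [self_mem_nhdsWithin] with x hx
      exact hgb x hx
    have hb2 : Filter.Tendsto (fun x : ℝ => x * φ x) (nhdsWithin 0 {0}ᶜ) (nhds 0) := by
      have h0 : Filter.Tendsto (fun x : ℝ => x) (nhdsWithin 0 {0}ᶜ) (nhds 0) :=
        Filter.tendsto_id.mono_left nhdsWithin_le_nhds
      refine h0.zero_mul_isBoundedUnder_le ⟨2 * m * lipConst h, ?_⟩
      rw [Filter.eventually_map]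
      filter_upwards [self_mem_nhdsWithin] with x hx
      exact hf' x hx
    have hk : Filter.Tendsto (fun x : ℝ => deriv h x + lam * f x) (nhdsWithin 0 {0}ᶜ)
        (nhds (deriv h 0 + lam * f 0)) := by
      have : Continuous (fun x : ℝ => deriv h x + lam * f x) := by fun_prop
      exact (this.tendsto 0).mono_left nhdsWithin_le_nhds
    have hall := ((hk.sub hb).add (hb2.const_mul lam)).div_const (r + 1)
    simp only [sub_zero, mul_zero, add_zero] at hall
    refine hall.congr' ?_
    filter_upwards [self_mem_nhdsWithin] with x hx
    have hx : x ≠ 0 := hx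
    have hr1 : r + 1 ≠ 0 := by linarith
    have : x * φd x = deriv h x + lam * f x - (r + 1 - lam * x) * φ x := by
      simp only [hφd]; field_simp
    rw [this]
    field_simp
    ring
  have hgc : Continuous g := by
    rw [continuous_iff_continuousAt]
    intro x
    by_cases hx : x = 0
    · rw [hx]; exact hg0
    · exact (hdg x hx).continuousAt
  have hfg : ∀ x, HasDerivAt f (g x) x :=
    hasDerivAt_of_hasDerivAt_of_ne' (x := 0) (fun y hy => by rw [hgφ y hy]; exact hd1 y hy)
      hfc.continuousAt hg0
  have hderiv : deriv f = g := funext fun x => (hfg x).deriv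
  have hgL := lip_of_bound_off_zero hgc hdg hgb
  rw [hderiv]
  constructor
  · rw [contDiff_one_iff_deriv, hderiv]
    exact ⟨fun x => (hfg x).differentiableAt, hgc⟩
  · apply LipschitzWith.of_dist_le_mul
    intro x y
    rw [Real.dist_eq, Real.dist_eq]
    refine (hgL x y).trans ?_
    gcongr
    refine le_trans (le_of_eq ?_) (Real.le_coe_toNNReal _)
    rw [hL2]; ring
end

section
/- Let r, λ > 0 and let h : ℝ → ℝ be a Borel-measurable function with E|h(X_{r,λ})| < ∞. Then on each of the two intervals (−∞, 0) and (0, ∞) there exists at most one bounded solution f of the Gamma Stein equation x f'(x) + (r − λx) f(x) = h(x) − E[h(X_{r,λ})]. -/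
open MeasureTheory ProbabilityTheory Real

/-- `f` is absolutely continuous on the interval `[a, b]`: for every `ε > 0` there is `δ > 0`
such that for every finite collection of pairwise non-overlapping subintervals
`(u i, v i) ⊆ [a, b]` of total length `< δ`, we have `∑ |f (v i) − f (u i)| < ε`. -/
def AbsContOn (f : ℝ → ℝ) (a b : ℝ) : Prop :=
  ∀ ε > (0 : ℝ), ∃ δ > (0 : ℝ), ∀ n : ℕ, ∀ u v : Fin n → ℝ,
    (∀ i, a ≤ u i ∧ u i ≤ v i ∧ v i ≤ b) →
    (∀ i j, i ≠ j → Disjoint (Set.Ioo (u i) (v i)) (Set.Ioo (u j) (v j))) →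
    (∑ i, (v i - u i)) < δ → (∑ i, |f (v i) - f (u i)|) < ε

/-- `f` is locally absolutely continuous on the (open) set `I`: it is absolutely continuous on
every compact subinterval of `I`. -/
def LocAbsContOn (f : ℝ → ℝ) (I : Set ℝ) : Prop :=
  ∀ a b : ℝ, a ≤ b → Set.Icc a b ⊆ I → AbsContOn f a b

/-- `f` is a solution of the Gamma Stein equation
`x f'(x) + (r − λ x) f(x) = h(x) − E[h(X_{r,λ})]` on the open interval `I`: it is locally
absolutely continuous on `I` and satisfies the equation at every point of `I` at which it is
differentiable. -/
def IsGammaSteinSolutionOn (r lam : ℝ) (h : ℝ → ℝ) (f : ℝ → ℝ) (I : Set ℝ) : Prop :=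
  LocAbsContOn f I ∧
    ∀ x ∈ I, DifferentiableAt ℝ f x →
      x * deriv f x + (r - lam * x) * f x = h x - ∫ y, h y ∂(gammaMeasure r lam)

theorem absContOn_to_mathlib {f : ℝ → ℝ} {a b : ℝ} (hab : a ≤ b) (hf : AbsContOn f a b) :
    AbsolutelyContinuousOnInterval f a b := by
  rw [absolutelyContinuousOnInterval_iff]
  intro ε hε
  obtain ⟨δ, hδ, H⟩ := hf ε hε
  refine ⟨δ, hδ, fun E hE hlen => ?_⟩
  obtain ⟨n, J⟩ := E
  obtain ⟨h1, h2⟩ := hE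
  simp only [Finset.mem_range] at h1 h2 hlen ⊢
  rw [Finset.sum_range] at hlen ⊢
  have key := H n (fun i => min (J i).1 (J i).2) (fun i => max (J i).1 (J i).2) ?_ ?_ ?_
  · refine lt_of_eq_of_lt (Finset.sum_congr rfl fun i _ => ?_) key
    rw [Real.dist_eq]
    rcases le_total (J i).1 (J i).2 with h | h
    · simp [h, abs_sub_comm]
    · simp [h]
  · intro i
    have := h1 i i.2
    rw [Set.uIcc_of_le hab] at this
    obtain ⟨⟨p, q⟩, ⟨s, t⟩⟩ := this
    exact ⟨le_min p s, min_le_max, max_le q t⟩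
  · intro i j hij
    have := h2 (by simp : (i : ℕ) ∈ (Finset.range n : Set ℕ))
      (by simp : (j : ℕ) ∈ (Finset.range n : Set ℕ)) (fun h => hij (Fin.ext h))
    exact this.mono Set.Ioo_subset_Ioc_self Set.Ioo_subset_Ioc_self
  · refine lt_of_eq_of_lt (Finset.sum_congr rfl fun i _ => ?_) hlen
    rw [Real.dist_eq, max_sub_min_eq_abs, abs_sub_comm]

theorem gamma_stein_aux
    (r lam : ℝ) (hr : 0 < r) (h : ℝ → ℝ) (I : Set ℝ) (hI : I.OrdConnected)
    (h0 : (0 : ℝ) ∉ I) (hne : (nhdsWithin (0 : ℝ) I).NeBot) (f g : ℝ → ℝ)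
    (hf : IsGammaSteinSolutionOn r lam h f I)
    (hg : IsGammaSteinSolutionOn r lam h g I)
    (bf : ∃ M : ℝ, ∀ x ∈ I, |f x| ≤ M)
    (bg : ∃ M : ℝ, ∀ x ∈ I, |g x| ≤ M) :
    Set.EqOn f g I := by
  obtain ⟨M, hM⟩ := bf
  obtain ⟨N, hN⟩ := bg
  set Φ : ℝ → ℝ := fun x => Real.exp (r * Real.log x - lam * x) with hΦ
  have hΦd : ∀ x ∈ I, HasDerivAt Φ (Φ x * (r * x⁻¹ - lam)) x := by
    intro x hx
    have hx0 : x ≠ 0 := fun h => h0 (h ▸ hx)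
    have := (((Real.hasDerivAt_log hx0).const_mul r).sub ((hasDerivAt_id x).const_mul lam)).exp
    simpa [hΦ] using this
  have const : ∀ a ∈ I, ∀ b ∈ I, a ≤ b → Φ a * (f a - g a) = Φ b * (f b - g b) := by
    intro a ha b hb hab
    have hsub : Set.Icc a b ⊆ I := hI.out ha hb
    have fac := absContOn_to_mathlib hab (hf.1 a b hab hsub)
    have gac := absContOn_to_mathlib hab (hg.1 a b hab hsub)
    have Φac : AbsolutelyContinuousOnInterval Φ a b := by
      apply ContDiffOn.absolutelyContinuousOnInterval
      rw [Set.uIcc_of_le hab]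
      intro x hx
      have hx0 : x ≠ 0 := fun h => h0 (h ▸ hsub hx)
      apply ContDiffAt.contDiffWithinAt
      exact ((contDiffAt_const.mul (Real.contDiffAt_log.2 hx0)).sub
        (contDiffAt_const.mul contDiffAt_id)).exp
    obtain ⟨C, hC⟩ := (Φac.fun_mul (fac.fun_sub gac)).const_of_ae_hasDerivAt_zero (by
      filter_upwards [fac.ae_differentiableAt, gac.ae_differentiableAt] with x h1 h2 hx
      have hxI : x ∈ I := hsub (by rwa [Set.uIcc_of_le hab] at hx)
      have hx0 : x ≠ 0 := fun h => h0 (h ▸ hxI)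
      have e1 := hf.2 x hxI (h1 hx)
      have e2 := hg.2 x hxI (h2 hx)
      refine ((hΦd x hxI).mul ((h1 hx).hasDerivAt.sub (h2 hx).hasDerivAt)).congr_deriv ?_
      have e3 : x * (deriv f x - deriv g x) + (r - lam * x) * (f x - g x) = 0 := by linarith
      have : deriv f x - deriv g x = - (r * x⁻¹ - lam) * (f x - g x) := by
        field_simp
        linarith
      rw [this, Pi.sub_apply]
      ring)
    rw [hC a (by simp), hC b (by simp)]
  have lim : Filter.Tendsto (fun x => Φ x * (f x - g x)) (nhdsWithin 0 I) (nhds 0) := by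
    have l1 : Filter.Tendsto Φ (nhdsWithin 0 I) (nhds 0) := by
      apply Real.tendsto_exp_atBot.comp
      have l2 : Filter.Tendsto (fun x => r * Real.log x) (nhdsWithin 0 I) Filter.atBot :=
        (Real.tendsto_log_nhdsNE_zero.const_mul_atBot hr).mono_left
          (nhdsWithin_mono _ fun x hx h => h0 (h ▸ hx))
      have l3 : Filter.Tendsto (fun x : ℝ => -(lam * x)) (nhdsWithin 0 I) (nhds (-(lam * 0))) :=
        (by fun_prop : Continuous fun x : ℝ => -(lam * x)).continuousAt.tendsto.mono_left
          nhdsWithin_le_nhds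
      simpa [sub_eq_add_neg] using l2.atBot_add l3
    have l4 := l1.mul_const (M + N)
    rw [zero_mul] at l4
    refine squeeze_zero_norm' ?_ l4
    filter_upwards [self_mem_nhdsWithin] with x hx
    rw [norm_mul, Real.norm_eq_abs, Real.norm_eq_abs, abs_of_pos (Real.exp_pos _)]
    gcongr
    exact (abs_sub _ _).trans (add_le_add (hM x hx) (hN x hx))
  intro x hx
  have hz : Φ x * (f x - g x) = 0 := by
    refine tendsto_nhds_unique (tendsto_const_nhds.congr' ?_) lim
    filter_upwards [self_mem_nhdsWithin] with y hy
    rcases le_total x y with hxy | hxy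
    · exact const x hx y hy hxy
    · exact (const y hy x hx hxy).symm
  have := (mul_eq_zero.1 hz).resolve_left (Real.exp_pos _).ne'
  linarith

/-- Lemma `unique`: for `r, λ > 0` and Borel-measurable `h : ℝ → ℝ` with
`E|h(X_{r,λ})| < ∞`, on each of the two intervals `(−∞, 0)` and `(0, ∞)` there is at most one
bounded solution of the Gamma Stein equation. -/
theorem gamma_stein_bounded_solution_unique
    (r lam : ℝ) (hr : 0 < r) (hlam : 0 < lam)
    (h : ℝ → ℝ) (hmeas : Measurable h)
    (hint : Integrable h (gammaMeasure r lam)) :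
    ∀ I ∈ ({Set.Iio (0 : ℝ), Set.Ioi (0 : ℝ)} : Set (Set ℝ)),
      ∀ f g : ℝ → ℝ,
        IsGammaSteinSolutionOn r lam h f I →
        IsGammaSteinSolutionOn r lam h g I →
        (∃ M : ℝ, ∀ x ∈ I, |f x| ≤ M) →
        (∃ M : ℝ, ∀ x ∈ I, |g x| ≤ M) →
        Set.EqOn f g I := by
  intro I hI f g hf hg bf bg
  rcases hI with rfl | rfl
  · exact gamma_stein_aux r lam hr h _ Set.ordConnected_Iio (by simp) inferInstance f g hf hg bf bg
  · exact gamma_stein_aux r lam hr h _ Set.ordConnected_Ioi (by simp) inferInstance f g hf hg bf bg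
end

section
/- Let a < b be real numbers and let f : [a,b] → ℝ satisfy: (a) f is continuous on [a,b]; (b) the restriction of f to [c,b] is absolutely continuous for each a < c < b; (c) there exist a < d < b, a set A ⊆ (a,d) at each of whose points f is differentiable with (a,d)∖A of Lebesgue measure zero, and a real number γ such that f'(x_n) → γ for every sequence (x_n) in A with x_n → a. Then f is absolutely continuous on [a,b], f is differentiable at a with f'(a) = γ, and the restriction of f' to A ∪ {a} is continuous at a. -/
open MeasureTheory Filter Topology

lemma AbsContOn.toInterval {f : ℝ → ℝ} {c b : ℝ} (hcb : c ≤ b) (h : AbsContOn f c b) :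
    AbsolutelyContinuousOnInterval f c b := by
  rw [absolutelyContinuousOnInterval_iff]
  intro ε hε
  obtain ⟨δ, hδ, H⟩ := h ε hε
  refine ⟨δ, hδ, ?_⟩
  rintro ⟨n, I⟩ hE hlen
  simp only [AbsolutelyContinuousOnInterval.disjWithin, Set.mem_setOf_eq, Set.uIcc_of_le hcb] at hE
  obtain ⟨h1, h2⟩ := hE
  simp only at hlen ⊢
  have key := H n (fun i => min (I i).1 (I i).2) (fun i => max (I i).1 (I i).2) ?_ ?_ ?_
  · rw [Finset.sum_range]
    convert key using 2 with i
    rw [Real.dist_eq]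
    rcases le_total (I i).1 (I i).2 with h | h
    · rw [min_eq_left h, max_eq_right h, abs_sub_comm]
    · rw [min_eq_right h, max_eq_left h]
  · intro i
    have := h1 i (by simp)
    simp only [Set.mem_Icc] at this
    exact ⟨le_min this.1.1 this.2.1, min_le_max, max_le this.1.2 this.2.2⟩
  · intro i j hij
    have := h2 (x := (i : ℕ)) (by simp) (y := (j : ℕ)) (by simp) (fun h => hij (Fin.ext h))
    exact this.mono Set.Ioo_subset_Ioc_self Set.Ioo_subset_Ioc_self
  · rw [Finset.sum_range] at hlen
    convert hlen using 2 with i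
    rw [Real.dist_eq, max_sub_min_eq_abs']

lemma key_bound
    (a b d γ : ℝ) (hab : a < b) (had : a < d) (hdb : d < b)
    (f : ℝ → ℝ) (A : Set ℝ)
    (hcont : ContinuousOn f (Set.Icc a b))
    (hAC : ∀ c : ℝ, a < c → c < b → AbsContOn f c b)
    (hA : A ⊆ Set.Ioo a d)
    (hnull : volume (Set.Ioo a d \ A) = 0)
    (c ε : ℝ) (hac : a < c) (hcd : c ≤ d)
    (hε : ∀ x ∈ A, x < c → |deriv f x - γ| ≤ ε) :
    ∀ x y, a ≤ x → x ≤ y → y ≤ c → |f y - f x - γ * (y - x)| ≤ ε * (y - x) := by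
  have main : ∀ x y, a < x → x ≤ y → y ≤ c → |f y - f x - γ * (y - x)| ≤ ε * (y - x) := by
    intro x y hx hxy hy
    have hac' : AbsolutelyContinuousOnInterval f x y := by
      refine ((hAC x hx (by linarith)).toInterval (by linarith)).mono ?_
      rw [Set.uIcc_of_le hxy, Set.uIcc_of_le (by linarith)]
      exact Set.Icc_subset_Icc le_rfl (by linarith)
    have h1 := hac'.integral_deriv_eq_sub
    have hi := hac'.intervalIntegrable_deriv
    have h2 : ∫ t in x..y, (deriv f t - γ) = f y - f x - γ * (y - x) := by
      rw [intervalIntegral.integral_sub hi (by simp), h1]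
      simp [mul_comm]
    rw [← h2, ← Real.norm_eq_abs]
    have h3 : ∀ᵐ t : ℝ, t ∈ Set.uIoc x y → ‖deriv f t - γ‖ ≤ ε := by
      have e1 : ∀ᵐ t : ℝ, t ∉ Set.Ioo a d \ A := measure_eq_zero_iff_ae_notMem.1 hnull
      have e2 : ∀ᵐ t : ℝ, t ≠ y := by simp [ae_iff, measure_singleton]
      filter_upwards [e1, e2] with t ht1 ht2 ht
      rw [Set.uIoc_of_le hxy] at ht
      have hty : t < y := lt_of_le_of_ne ht.2 ht2
      have htA : t ∈ A := by
        by_contra hn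
        exact ht1 ⟨⟨by linarith [ht.1], by linarith⟩, hn⟩
      exact hε t htA (by linarith)
    have := intervalIntegral.norm_integral_le_of_norm_le_const_ae h3
    rwa [abs_of_nonneg (by linarith : 0 ≤ y - x)] at this
  intro x y hx hxy hy
  rcases hx.lt_or_eq with hx | rfl
  · exact main x y hx hxy hy
  rcases hxy.lt_or_eq with hxy | rfl
  · have hca : Tendsto f (𝓝[>] a) (𝓝 (f a)) := by
      have := hcont a ⟨le_rfl, hab.le⟩
      have h2 := this.mono Set.Ioo_subset_Icc_self
      unfold ContinuousWithinAt at h2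
      rwa [nhdsWithin_Ioo_eq_nhdsGT hab] at h2
    have hid : Tendsto (fun x : ℝ => x) (𝓝[>] a) (𝓝 a) := nhdsWithin_le_nhds
    refine le_of_tendsto_of_tendsto
      (((tendsto_const_nhds (x := f y)).sub hca).sub
        ((tendsto_const_nhds (x := y)).sub hid |>.const_mul γ)).abs
      (((tendsto_const_nhds (x := y)).sub hid).const_mul ε) ?_
    filter_upwards [Ioo_mem_nhdsGT hxy] with x hx
    exact main x y hx.1 hx.2.le hy
  · simp

/-- Lemma `fprimelemma`: let `a < b` and let `f : [a,b] → ℝ` (here a function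
on `ℝ`, with all conditions on `[a,b]`) be such that
(a) `f` is continuous on `[a,b]`;
(b) `f` is absolutely continuous on `[c,b]` for each `a < c < b`;
(c) there are `a < d < b`, a set `A ⊆ (a,d)` at each of whose points `f` is differentiable with
`(a,d) ∖ A` Lebesgue-null, and `γ ∈ ℝ` with `f'(xₙ) → γ` for every sequence `(xₙ) ⊆ A` with
`xₙ → a`.
Then `f` is absolutely continuous on `[a,b]`, `f` is differentiable at `a` (within `[a,b]`) with
`f'(a) = γ`, and `f'` restricted to `A ∪ {a}` is continuous at `a`. -/
theorem absolutelyContinuous_of_deriv_limit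
    (a b d γ : ℝ) (hab : a < b) (had : a < d) (hdb : d < b)
    (f : ℝ → ℝ) (A : Set ℝ)
    (hcont : ContinuousOn f (Set.Icc a b))
    (hAC : ∀ c : ℝ, a < c → c < b → AbsContOn f c b)
    (hA : A ⊆ Set.Ioo a d)
    (hdiff : ∀ x ∈ A, DifferentiableAt ℝ f x)
    (hnull : volume (Set.Ioo a d \ A) = 0)
    (hlim : ∀ x : ℕ → ℝ, (∀ n, x n ∈ A) → Tendsto x atTop (𝓝 a) →
      Tendsto (fun n => deriv f (x n)) atTop (𝓝 γ)) :
    AbsContOn f a b ∧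
      HasDerivWithinAt f γ (Set.Icc a b) a ∧
      ContinuousWithinAt (fun x => if x = a then γ else deriv f x) (A ∪ {a}) a := by
  have hε : ∀ ε > 0, ∃ c, a < c ∧ c ≤ d ∧ ∀ x ∈ A, x < c → |deriv f x - γ| ≤ ε := by
    intro ε hε
    by_contra! hcon
    have hx : ∀ n : ℕ, ∃ x ∈ A, x < a + (d - a) / ((n : ℝ) + 1) ∧ ε < |deriv f x - γ| := by
      intro n
      refine hcon _ (lt_add_of_pos_right _ (div_pos (by linarith) (by positivity))) ?_
      have : (d - a) / ((n : ℝ) + 1) ≤ d - a :=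
        div_le_self (by linarith) (by linarith [n.cast_nonneg (α := ℝ)])
      linarith
    choose x hxA hxl hxb using hx
    have hta : Tendsto x atTop (𝓝 a) := by
      have hu : Tendsto (fun n : ℕ => a + (d - a) / ((n : ℝ) + 1)) atTop (𝓝 a) := by
        have := (tendsto_one_div_add_atTop_nhds_zero_nat (𝕜 := ℝ)).const_mul (d - a)
        have := this.const_add a
        simpa [div_eq_mul_inv] using this
      exact tendsto_of_tendsto_of_tendsto_of_le_of_le tendsto_const_nhds hu
        (fun n => (hA (hxA n)).1.le) (fun n => (hxl n).le)
    have ht := hlim x hxA hta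
    obtain ⟨N, hN⟩ := (Metric.tendsto_atTop.1 ht) ε hε
    have := hN N le_rfl
    rw [Real.dist_eq] at this
    linarith [hxb N]
  have hkey := key_bound a b d γ hab had hdb f A hcont hAC hA hnull
  refine ⟨?_, ?_, ?_⟩
  · intro ε hεp
    obtain ⟨c, hac, hcd, hc⟩ := hε 1 one_pos
    have hL := hkey c 1 hac hcd hc
    obtain ⟨δ, hδ, H⟩ := hAC c hac (by linarith) (ε / 2) (by linarith)
    have hK : 0 < |γ| + 1 := by positivity
    refine ⟨min δ (ε / 2 / (|γ| + 1)), lt_min hδ (by positivity), ?_⟩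
    intro n u v huv hdisj hsum
    have hs1 := hsum.trans_le (min_le_left _ _)
    have hs2 := hsum.trans_le (min_le_right _ _)
    rw [lt_div_iff₀ hK] at hs2
    have hR := H n (fun i => max (u i) c) (fun i => max (v i) c) ?_ ?_ ?_
    · have hle : ∀ i, |f (v i) - f (u i)| ≤
          (v i - u i) * (|γ| + 1) + |f (max (v i) c) - f (max (u i) c)| := by
        intro i
        obtain ⟨h1, h2, h3⟩ := huv i
        have hlip : ∀ x y, a ≤ x → x ≤ y → y ≤ c → |f y - f x| ≤ (y - x) * (|γ| + 1) := by
          intro x y hx hxy hy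
          have e := hL x y hx hxy hy
          have e2 := abs_add_le (f y - f x - γ * (y - x)) (γ * (y - x))
          rw [abs_mul, abs_of_nonneg (sub_nonneg.2 hxy), sub_add_cancel] at e2
          linarith
        rcases le_total (v i) c with hv | hv
        · rw [max_eq_right hv, max_eq_right (h2.trans hv)]
          simpa using hlip _ _ h1 h2 hv
        · rcases le_total (u i) c with hu | hu
          · rw [max_eq_left hv, max_eq_right hu]
            have e := hlip _ _ h1 hu le_rfl
            have e2 := abs_sub_le (f (v i)) (f c) (f (u i))
            have e3 : (c - u i) * (|γ| + 1) ≤ (v i - u i) * (|γ| + 1) := by gcongr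
            linarith
          · rw [max_eq_left hv, max_eq_left hu]
            have : 0 ≤ (v i - u i) * (|γ| + 1) := mul_nonneg (sub_nonneg.2 h2) hK.le
            linarith
      have hS := Finset.sum_le_sum (s := Finset.univ) (fun i _ => hle i)
      rw [Finset.sum_add_distrib, ← Finset.sum_mul] at hS
      linarith
    · intro i
      obtain ⟨h1, h2, h3⟩ := huv i
      exact ⟨le_max_right _ _, max_le_max_right _ h2, max_le h3 (by linarith)⟩
    · intro i j hij
      rw [Set.disjoint_left]
      intro x hx hy
      simp only [Set.mem_Ioo, max_lt_iff, lt_max_iff] at hx hy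
      have hd := Set.disjoint_left.1 (hdisj i j hij)
      refine @hd x ⟨hx.1.1, ?_⟩ ⟨hy.1.1, ?_⟩
      · exact hx.2.resolve_right (by linarith [hx.1.2])
      · exact hy.2.resolve_right (by linarith [hx.1.2])
    · refine lt_of_le_of_lt (Finset.sum_le_sum fun i _ => ?_) hs1
      obtain ⟨h1, h2, h3⟩ := huv i
      rcases le_total (u i) c with hu | hu <;> rcases le_total (v i) c with hv | hv <;>
        simp only [max_eq_left, max_eq_right, hu, hv] <;> linarith
  · rw [hasDerivWithinAt_iff_isLittleO, Asymptotics.isLittleO_iff]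
    intro ε hεp
    obtain ⟨c, hac, hcd, hc⟩ := hε ε hεp
    have hL := hkey c ε hac hcd hc
    filter_upwards [self_mem_nhdsWithin, mem_nhdsWithin_of_mem_nhds (Iio_mem_nhds hac)] with x hx hxc
    have := hL a x le_rfl hx.1 (le_of_lt hxc)
    rw [Real.norm_eq_abs, Real.norm_eq_abs, abs_of_nonneg (sub_nonneg.2 hx.1), smul_eq_mul,
      mul_comm (x - a)]
    exact this
  · rw [Metric.continuousWithinAt_iff]
    intro ε hεp
    obtain ⟨c, hac, hcd, hc⟩ := hε (ε / 2) (by linarith)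
    refine ⟨c - a, by linarith, ?_⟩
    rintro x hx hxd
    rw [Real.dist_eq] at hxd ⊢
    by_cases hxa : x = a
    · simpa [hxa] using hεp
    · have hxA : x ∈ A := hx.resolve_right hxa
      have := hc x hxA (by linarith [le_abs_self (x - a)])
      simp only [hxa, if_true, if_false]
      linarith
end
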